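/- arXiv:1709.02266 — 3 statements merged into one kernel-verified Lean document; each statement's English description precedes it below -/
import Mathlib

section
/- Let a<b and V1,V2 ∈ C²((0,1)) be continuous at 0 and 1, and assume W1(p)=V1(p)−log(p(1−p)) and W2(p)=V2(p)−log(p(1−p)) have unique minimizers p1*, p2* ∈ (0,1). Fix k ≥ 1 and for each n let X^(n) be distributed according to ℙ_{n,[a,b],V1,V2}. Define I: M_k([a,b]) → [0,∞] by I(m) = ∞ for m ∈ ∂M_k([a,b]) and, for m ∈ Int(M_k([a,b])) with canonical moments p_1,…,p_k, I(m) = Σ_{j=1}^{⌊(k+1)/2⌋} (W1(p_{2j−1}) − W1(p1*)) + Σ_{j=1}^{⌊k/2⌋} (W2(p_{2j}) − W2(p2*)). Then the sequence of first k coordinates (X^(n)_1,…,X^(n)_k) satisfies a large deviations principle on M_k([a,b]) with speed n and good rate function I: I is lower semicontinuous with compact sublevel sets, for every open set O ⊆ ℝ^k one has liminf_{n→∞} (1/n) log ℙ((X^(n)_1,…,X^(n)_k) ∈ O) ≥ −inf_{m ∈ O} I(m), and for every closed set U ⊆ ℝ^k one has limsup_{n→∞} (1/n) log ℙ((X^(n)_1,…,X^(n)_k)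 ∈ U) ≤ −inf_{m ∈ U} I(m) (with I := ∞ outside M_k([a,b])). -/
open MeasureTheory Real Filter Topology Polynomial

noncomputable section
/-- The `n`-th moment space of Borel probability measures supported on `E ⊆ ℝ`
with all moments finite. -/
def momentSpace (E : Set ℝ) (n : ℕ) : Set (Fin n → ℝ) :=
  {v | ∃ μ : Measure ℝ, IsProbabilityMeasure μ ∧ μ Eᶜ = 0 ∧
      (∀ j : ℕ, Integrable (fun x => x ^ j) μ) ∧
      ∀ j : Fin n, v j = ∫ x, x ^ ((j : ℕ) + 1) ∂μ}
/-- The set of possible values for the `k`-th moment of a probability measure on `[a,b]`,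
given that its moments of order `< k` agree with the corresponding entries of `v`. -/
def momentSection (a b : ℝ) {n : ℕ} (v : Fin n → ℝ) (k : ℕ) : Set ℝ :=
  {m | ∃ μ : Measure ℝ, IsProbabilityMeasure μ ∧ μ (Set.Icc a b)ᶜ = 0 ∧
      (∀ i : Fin n, (i : ℕ) + 1 < k → ∫ x, x ^ ((i : ℕ) + 1) ∂μ = v i) ∧
      m = ∫ x, x ^ k ∂μ}

/-- The `(j+1)`-st canonical moment (`1`-based index `j+1`) of a point of the moment space
`M_n([a,b])`. -/
def canCompact (a b : ℝ) {n : ℕ} (v : Fin n → ℝ) (j : Fin n) : ℝ :=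
  (v j - sInf (momentSection a b v ((j : ℕ) + 1))) /
    (sSup (momentSection a b v ((j : ℕ) + 1)) - sInf (momentSection a b v ((j : ℕ) + 1)))

/-- The (unnormalized) density of `ℙ_{n,[a,b],V₁,V₂}` in terms of canonical moments:
odd (1-based) canonical moments get the potential `V₁`, even ones `V₂`. -/
def canDensityC (a b : ℝ) (V1 V2 : ℝ → ℝ) {n : ℕ} (v : Fin n → ℝ) : ℝ :=
  Real.exp (-(n : ℝ) * ∑ j : Fin n,
    (if (j : ℕ) % 2 = 0 then V1 (canCompact a b v j) else V2 (canCompact a b v j)))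

/-- `P` is the distribution `ℙ_{n,[a,b],V₁,V₂}`: a probability measure giving no mass to the
boundary of the moment space and with Lebesgue density on the interior proportional to
`exp[-n Σ V₁(p_odd) - n Σ V₂(p_even)]`. -/
def isCompactDist (a b : ℝ) (V1 V2 : ℝ → ℝ) (n : ℕ) (P : Measure (Fin n → ℝ)) : Prop :=
  IsProbabilityMeasure P ∧ ∃ Z : ℝ, 0 < Z ∧
    P = (ENNReal.ofReal Z)⁻¹ •
      ((volume.restrict (interior (momentSpace (Set.Icc a b) n))).withDensity
        (fun v => ENNReal.ofReal (canDensityC a b V1 V2 v)))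

/-- The effective potential `W(p) = V(p) - log(p(1-p))`. -/
def effW (V : ℝ → ℝ) (p : ℝ) : ℝ := V p - Real.log (p * (1 - p))

open scoped Classical

/-- The rate function of the LDP for random moment vectors on `M_k([a,b])`:
`I(m) = Σ_j (W₁(p_{2j-1}) - W₁(p₁*)) + Σ_j (W₂(p_{2j}) - W₂(p₂*))` on the interior of the
moment space, `∞` elsewhere. -/
def rateC (a b : ℝ) (V1 V2 : ℝ → ℝ) (p1s p2s : ℝ) (k : ℕ) (m : Fin k → ℝ) : EReal :=
  if m ∈ interior (momentSpace (Set.Icc a b) k) then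
    (((∑ j : Fin k, (if (j : ℕ) % 2 = 0
        then effW V1 (canCompact a b m j) - effW V1 p1s
        else effW V2 (canCompact a b m j) - effW V2 p2s)) : ℝ) : EReal)
  else ⊤

namespace CanonicalMoments

/-- The complementary canonical moments, shifted by one and started with `1`. -/
def coCanon (x : ℕ → ℝ) : ℕ → ℝ
  | 0 => 1
  | i + 1 => 1 - x i

/-- The coefficients of the Stieltjes continued fraction with canonical moments `x`. -/
def zeta (x : ℕ → ℝ) (h : ℕ) : ℝ := coCanon x h * x h

/-- The sum of the weights of all nonnegative lattice paths of length `n` from height `h` to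
height `0`, a down-step from height `i + 1` having weight `z i`. -/
def pathSum (z : ℕ → ℝ) : ℕ → ℕ → ℝ
  | 0, 0 => 1
  | 0, _ + 1 => 0
  | n + 1, 0 => pathSum z n 1
  | n + 1, h + 1 => pathSum z n (h + 2) + z h * pathSum z n h

lemma pathSum_eq_zero_of_lt (z : ℕ → ℝ) (n h : ℕ) (hn : n < h) : pathSum z n h = 0 := by
  induction n generalizing h with
  | zero => obtain ⟨h, rfl⟩ := Nat.exists_eq_add_of_lt hn; simp [pathSum]
  | succ n ih =>
    obtain ⟨h, rfl⟩ : ∃ m, h = m + 1 := ⟨h - 1, by omega⟩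
    simp [pathSum, ih (h + 2) (by omega), ih h (by omega)]

lemma pathSum_eq_zero_of_odd (z : ℕ → ℝ) (n h : ℕ) (hn : (n + h) % 2 = 1) :
    pathSum z n h = 0 := by
  induction n generalizing h with
  | zero =>
    obtain ⟨h, rfl⟩ : ∃ m, h = m + 1 := ⟨h - 1, by omega⟩
    simp [pathSum]
  | succ n ih =>
    cases h with
    | zero => simp [pathSum, ih 1 (by omega)]
    | succ h => simp [pathSum, ih (h + 2) (by omega), ih h (by omega)]

lemma pathSum_self (z : ℕ → ℝ) (n : ℕ) : pathSum z n n = ∏ i ∈ Finset.range n, z i := by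
  induction n with
  | zero => simp [pathSum]
  | succ n ih =>
    simp [pathSum, pathSum_eq_zero_of_lt z n (n + 2) (by omega), ih, Finset.prod_range_succ,
      mul_comm]

lemma pathSum_congr {z z' : ℕ → ℝ} {j : ℕ} (hz : ∀ i < j, z i = z' i) (n h : ℕ)
    (hn : n + h < 2 * (j + 1)) : pathSum z n h = pathSum z' n h := by
  induction n generalizing h with
  | zero => cases h <;> simp [pathSum]
  | succ n ih =>
    cases h with
    | zero => simp [pathSum, ih 1 (by omega)]
    | succ h =>
      by_cases hj : h < j
      · simp [pathSum, ih (h + 2) (by omega), ih h (by omega), hz h hj]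
      · simp [pathSum, ih (h + 2) (by omega), pathSum_eq_zero_of_lt _ n h (by omega)]

lemma pathSum_sub {z z' : ℕ → ℝ} {j : ℕ} (hz : ∀ i < j, z i = z' i) (n h : ℕ)
    (hn : n + h = 2 * (j + 1)) (hh : h ≤ j + 1) :
    pathSum z n h - pathSum z' n h = (∏ i ∈ Finset.range j, z i) * (z j - z' j) := by
  induction n generalizing h with
  | zero => omega
  | succ n ih =>
    cases h with
    | zero => simpa [pathSum] using ih 1 (by omega) (by omega)
    | succ h =>
      rcases Nat.lt_or_ge h j with hj | hj
      · have h1 := ih (h + 2) (by omega) (by omega)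
        have h2 := pathSum_congr hz n h (by omega)
        simp only [pathSum, hz h hj, h2]
        linarith
      · obtain rfl : h = j := by omega
        obtain rfl : n = h := by omega
        have h2 := pathSum_congr hz n n (by omega)
        simp only [pathSum, pathSum_eq_zero_of_lt _ n (n + 2) (by omega : n < n + 2), ← h2,
          pathSum_self]
        ring

/-- The linear functional on polynomials with moment sequence `c`. -/
def momentFunctional (c : ℕ → ℝ) : ℝ[X] →ₗ[ℝ] ℝ :=
  Polynomial.lsum fun n => c n • LinearMap.id

lemma momentFunctional_apply (c : ℕ → ℝ) (f : ℝ[X]) :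
    momentFunctional c f = f.sum fun n r => c n * r := by
  simp [momentFunctional, Polynomial.lsum_apply]

@[simp] lemma momentFunctional_X_pow (c : ℕ → ℝ) (n : ℕ) : momentFunctional c (X ^ n) = c n := by
  rw [momentFunctional_apply, Polynomial.X_pow_eq_monomial, Polynomial.sum_monomial_index] <;> simp

lemma map_C_mul (L : ℝ[X] →ₗ[ℝ] ℝ) (r : ℝ) (f : ℝ[X]) : L (C r * f) = r * L f := by
  rw [← Polynomial.smul_eq_C_mul, map_smul, smul_eq_mul]

/-- The orthogonal polynomials of the functional with continued fraction coefficients `z`. -/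
def orthoPoly (z : ℕ → ℝ) : ℕ → ℝ[X]
  | 0 => 1
  | 1 => X
  | h + 2 => X * orthoPoly z (h + 1) - C (z h) * orthoPoly z h

lemma orthoPoly_monic_natDegree (z : ℕ → ℝ) (h : ℕ) :
    ((orthoPoly z h).Monic ∧ (orthoPoly z h).natDegree = h) ∧
    ((orthoPoly z (h + 1)).Monic ∧ (orthoPoly z (h + 1)).natDegree = h + 1) := by
  induction h with
  | zero => simp [orthoPoly, Polynomial.monic_X]
  | succ h ih =>
    obtain ⟨⟨m1, d1⟩, m2, d2⟩ := ih
    refine ⟨⟨m2, d2⟩, ?_⟩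
    have hm : (X * orthoPoly z (h + 1)).Monic := Polynomial.monic_X.mul m2
    have hd : (X * orthoPoly z (h + 1)).natDegree = h + 2 := by
      rw [Polynomial.monic_X.natDegree_mul m2, d2, Polynomial.natDegree_X]; ring
    have hlt : (C (z h) * orthoPoly z h).degree < (X * orthoPoly z (h + 1)).degree := by
      rw [← Polynomial.smul_eq_C_mul]
      refine (Polynomial.degree_smul_le _ _).trans_lt ?_
      rw [Polynomial.degree_eq_natDegree m1.ne_zero, Polynomial.degree_eq_natDegree hm.ne_zero,
        d1, hd]
      exact_mod_cast (by omega : h < h + 2)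
    refine ⟨hm.sub_of_left hlt, ?_⟩
    refine Eq.trans ?_ hd
    exact Polynomial.natDegree_eq_of_degree_eq (Polynomial.degree_sub_eq_left_of_degree_lt hlt)

lemma orthoPoly_monic (z : ℕ → ℝ) (h : ℕ) : (orthoPoly z h).Monic :=
  (orthoPoly_monic_natDegree z h).1.1

lemma orthoPoly_natDegree (z : ℕ → ℝ) (h : ℕ) : (orthoPoly z h).natDegree = h :=
  (orthoPoly_monic_natDegree z h).1.2

lemma functional_X_pow_mul_orthoPoly (z : ℕ → ℝ) (h n : ℕ) :
    momentFunctional (fun n => pathSum z n 0) (X ^ n * orthoPoly z h) = pathSum z n h ∧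
    momentFunctional (fun n => pathSum z n 0) (X ^ n * orthoPoly z (h + 1)) =
      pathSum z n (h + 1) := by
  induction h generalizing n with
  | zero =>
    refine ⟨by simp [orthoPoly], ?_⟩
    rw [zero_add, orthoPoly, ← pow_succ, momentFunctional_X_pow, pathSum]
  | succ h ih =>
    refine ⟨(ih n).2, ?_⟩
    have : X ^ n * orthoPoly z (h + 2) =
        X ^ (n + 1) * orthoPoly z (h + 1) - C (z h) * (X ^ n * orthoPoly z h) := by
      rw [orthoPoly]; ring
    rw [this, map_sub, map_C_mul, (ih (n + 1)).2, (ih n).1, pathSum]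
    ring

/-- Pairing the `h`-th orthogonal polynomial with a monic polynomial of degree `h`. -/
lemma functional_monic_mul_orthoPoly (z : ℕ → ℝ) {h : ℕ} {f : ℝ[X]} (hf : f.Monic)
    (hd : f.natDegree = h) :
    momentFunctional (fun n => pathSum z n 0) (f * orthoPoly z h) =
      ∏ i ∈ Finset.range h, z i := by
  have key : ∀ n, momentFunctional (fun n => pathSum z n 0) (X ^ n * orthoPoly z h) =
      pathSum z n h := fun n => (functional_X_pow_mul_orthoPoly z h n).1
  conv_lhs => rw [hf.as_sum, hd]
  rw [add_mul, map_add, key, pathSum_self, Finset.sum_mul, map_sum, Finset.sum_eq_zero, add_zero]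
  intro i hi
  rw [mul_assoc, map_C_mul, key, pathSum_eq_zero_of_lt _ _ _ (Finset.mem_range.1 hi), mul_zero]

/-- Pairing the `h`-th orthogonal polynomial with a polynomial of smaller degree. -/
lemma functional_mul_orthoPoly_eq_zero (z : ℕ → ℝ) {h : ℕ} {f : ℝ[X]}
    (hd : f.natDegree < h) :
    momentFunctional (fun n => pathSum z n 0) (f * orthoPoly z h) = 0 := by
  conv_lhs => rw [f.as_sum_range_C_mul_X_pow]
  rw [Finset.sum_mul, map_sum, Finset.sum_eq_zero]
  intro i hi
  rw [mul_assoc, map_C_mul, (functional_X_pow_mul_orthoPoly z h i).1,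
    pathSum_eq_zero_of_lt _ _ _ (by have := Finset.mem_range.1 hi; omega), mul_zero]

/-- The orthogonal polynomials after multiplication of the measure by `1 - t ^ 2`. -/
def kernelPoly (x : ℕ → ℝ) (n : ℕ) : ℝ[X] :=
  orthoPoly (fun i => x i * (1 - x (i + 1))) n

lemma kernelPoly_identity (x : ℕ → ℝ) (n : ℕ) :
    (X ^ 2 - 1) * kernelPoly x n =
      X * orthoPoly (zeta x) (n + 1) - C (coCanon x n) * orthoPoly (zeta x) n ∧
    (X ^ 2 - 1) * kernelPoly x (n + 1) =
      X * orthoPoly (zeta x) (n + 2) - C (coCanon x (n + 1)) * orthoPoly (zeta x) (n + 1) := by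
  induction n with
  | zero =>
    refine ⟨by simp [kernelPoly, orthoPoly, coCanon, sq], ?_⟩
    simp only [kernelPoly, orthoPoly, coCanon, zeta, map_sub, map_one, map_mul]
    ring
  | succ n ih =>
    obtain ⟨h1, h2⟩ := ih
    refine ⟨h2, ?_⟩
    simp only [kernelPoly, zeta, orthoPoly, coCanon, map_sub, map_one, map_mul] at h1 h2 ⊢
    linear_combination X * h2 - C (x n) * (1 - C (x (n + 1))) * h1

/-- The product of the canonical moments and their complements: the range of the `(j + 1)`-st
moment, given the first `j`, on the unit interval. -/
def canonRange (x : ℕ → ℝ) (j : ℕ) : ℝ := ∏ i ∈ Finset.range j, x i * (1 - x i)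

lemma prod_zeta_mul_coCanon (x : ℕ → ℝ) (j : ℕ) :
    (∏ i ∈ Finset.range j, zeta x i) * coCanon x j = canonRange x j := by
  induction j with
  | zero => simp [coCanon, canonRange]
  | succ j ih =>
    rw [canonRange, Finset.prod_range_succ, Finset.prod_range_succ, ← canonRange, ← ih, zeta,
      coCanon]
    ring

lemma functional_sq_orthoPoly (x : ℕ → ℝ) (j : ℕ) :
    momentFunctional (fun n => pathSum (zeta x) n 0) (orthoPoly (zeta x) (j + 1) ^ 2) =
      canonRange x j * x j := by
  rw [sq, functional_monic_mul_orthoPoly _ (orthoPoly_monic _ _) (orthoPoly_natDegree _ _),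
    Finset.prod_range_succ, ← prod_zeta_mul_coCanon, zeta]
  ring

lemma functional_sq_kernelPoly (x : ℕ → ℝ) (j : ℕ) :
    momentFunctional (fun n => pathSum (zeta x) n 0) ((1 - X ^ 2) * kernelPoly x j ^ 2) =
      canonRange x j * (1 - x j) := by
  have h := (kernelPoly_identity x j).1
  have e : (1 - X ^ 2) * kernelPoly x j ^ 2 =
      C (coCanon x j * (1 - x j)) * (kernelPoly x j * orthoPoly (zeta x) j) -
        kernelPoly x j * orthoPoly (zeta x) (j + 2) := by
    rw [orthoPoly, zeta]
    simp only [map_sub, map_one, map_mul]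
    linear_combination -kernelPoly x j * h
  have hd : (kernelPoly x j).natDegree = j := orthoPoly_natDegree _ _
  have hm : (kernelPoly x j).Monic := orthoPoly_monic _ _
  rw [e, map_sub, map_C_mul, functional_monic_mul_orthoPoly _ hm hd,
    functional_mul_orthoPoly_eq_zero _ (by omega), ← prod_zeta_mul_coCanon]
  ring

lemma functional_sub_eq {L L' : ℝ[X] →ₗ[ℝ] ℝ} {N : ℕ}
    (h : ∀ n < N, L (X ^ n) = L' (X ^ n)) {f : ℝ[X]} (hf : f.natDegree ≤ N) :
    L f - L' f = f.coeff N * (L (X ^ N) - L' (X ^ N)) := by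
  have hsum := f.as_sum_range_C_mul_X_pow' (Nat.lt_succ_of_le hf)
  rw [Finset.sum_range_succ] at hsum
  have hlow : L (∑ i ∈ Finset.range N, C (f.coeff i) * X ^ i) =
      L' (∑ i ∈ Finset.range N, C (f.coeff i) * X ^ i) := by
    rw [map_sum, map_sum]
    refine Finset.sum_congr rfl fun n hn => ?_
    rw [map_C_mul, map_C_mul, h n (Finset.mem_range.1 hn)]
  have e := fun Λ : ℝ[X] →ₗ[ℝ] ℝ => congrArg Λ hsum
  simp only [map_add, map_C_mul] at e
  rw [e L, e L', hlow]
  ring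

/-- The polynomial whose powers have the moments on `[a, b]` as expectations. -/
def intervalPoly (a b : ℝ) : ℝ[X] := C a + C (b - a) * X ^ 2

lemma functional_even_eq {a b : ℝ} (hab : a < b) {L L' : ℝ[X] →ₗ[ℝ] ℝ} {j : ℕ}
    (h : ∀ i ≤ j, L (intervalPoly a b ^ i) = L' (intervalPoly a b ^ i)) {l : ℕ} (hl : l ≤ j) :
    L (X ^ (2 * l)) = L' (X ^ (2 * l)) := by
  have hba : b - a ≠ 0 := (sub_pos.2 hab).ne'
  have e : (X : ℝ[X]) ^ (2 * l) =
      C (((b - a)⁻¹) ^ l) * ∑ i ∈ Finset.range (l + 1),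
        C ((-a) ^ (l - i) * (l.choose i : ℝ)) * intervalPoly a b ^ i := by
    have : (X : ℝ[X]) ^ 2 = C ((b - a)⁻¹) * (intervalPoly a b + C (-a)) := by
      rw [intervalPoly, add_comm (C a), add_assoc, ← map_add, add_neg_cancel, map_zero, add_zero,
        ← mul_assoc, ← map_mul, inv_mul_cancel₀ hba, map_one, one_mul]
    rw [pow_mul, this, mul_pow, add_pow, ← map_pow]
    congr 1
    refine Finset.sum_congr rfl fun i _ => ?_
    rw [map_mul, map_pow, map_natCast]
    ring
  rw [e, map_C_mul, map_C_mul, map_sum, map_sum]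
  congr 1
  refine Finset.sum_congr rfl fun i hi => ?_
  rw [map_C_mul, map_C_mul, h i (by have := Finset.mem_range.1 hi; omega)]

lemma intervalPoly_pow_natDegree_le (a b : ℝ) (j : ℕ) :
    (intervalPoly a b ^ j).natDegree ≤ 2 * j := by
  rw [mul_comm]
  refine Polynomial.natDegree_pow_le_of_le j ?_
  rw [intervalPoly]
  compute_degree

lemma intervalPoly_pow_coeff (a b : ℝ) (j : ℕ) :
    (intervalPoly a b ^ j).coeff (2 * j) = (b - a) ^ j := by
  rw [mul_comm, Polynomial.coeff_pow_of_natDegree_le]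
  · congr 1
    rw [intervalPoly, Polynomial.coeff_add, Polynomial.coeff_C_mul]
    simp
  · rw [intervalPoly]
    compute_degree

/-- The moments on `[a, b]` with canonical moments `x`. -/
def canonMoment (a b : ℝ) (x : ℕ → ℝ) (i : ℕ) : ℝ :=
  momentFunctional (fun n => pathSum (zeta x) n 0) (intervalPoly a b ^ i)

lemma zeta_congr {x x' : ℕ → ℝ} {j : ℕ} (h : ∀ i < j, x i = x' i) (i : ℕ) (hi : i < j) :
    zeta x i = zeta x' i := by
  cases i with
  | zero => simp [zeta, coCanon, h 0 hi]
  | succ i => simp [zeta, coCanon, h (i + 1) hi, h i (by omega)]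

lemma functional_path_congr {x x' : ℕ → ℝ} {j : ℕ} (h : ∀ i < j, x i = x' i) (n : ℕ)
    (hn : n < 2 * (j + 1)) : momentFunctional (fun n => pathSum (zeta x) n 0) (X ^ n) =
      momentFunctional (fun n => pathSum (zeta x') n 0) (X ^ n) := by
  simp only [momentFunctional_X_pow]
  exact pathSum_congr (zeta_congr h) n 0 (by omega)

lemma canonMoment_congr {a b : ℝ} {x x' : ℕ → ℝ} {j : ℕ} (h : ∀ i < j, x i = x' i) {i : ℕ}
    (hi : i ≤ j) : canonMoment a b x i = canonMoment a b x' i := by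
  have := functional_sub_eq (N := 2 * i) (fun n hn => functional_path_congr h n (by omega))
    (intervalPoly_pow_natDegree_le a b i)
  rw [functional_path_congr h _ (by omega), sub_self, mul_zero] at this
  exact sub_eq_zero.1 this

lemma canonMoment_succ_sub {a b : ℝ} {x x' : ℕ → ℝ} {j : ℕ} (h : ∀ i < j, x i = x' i) :
    canonMoment a b x (j + 1) - canonMoment a b x' (j + 1) =
      (b - a) ^ (j + 1) * canonRange x j * (x j - x' j) := by
  have h1 := functional_sub_eq (N := 2 * (j + 1)) (functional_path_congr h)
    (intervalPoly_pow_natDegree_le a b (j + 1))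
  rw [canonMoment, canonMoment, h1, intervalPoly_pow_coeff, momentFunctional_X_pow,
    momentFunctional_X_pow, pathSum_sub (zeta_congr h) _ _ (by omega) (by omega),
    ← prod_zeta_mul_coCanon, zeta, zeta]
  have : coCanon x' j = coCanon x j := by
    cases j with
    | zero => rfl
    | succ j => simp [coCanon, h j (by omega)]
  rw [this]
  ring

lemma integrable_of_continuous {a b : ℝ} {μ : Measure ℝ} [IsFiniteMeasure μ]
    (hμ : μ (Set.Icc a b)ᶜ = 0) {g : ℝ → ℝ} (hg : Continuous g) : Integrable g μ := by
  have : μ.restrict (Set.Icc a b) = μ := Measure.restrict_eq_self_of_ae_mem hμ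
  rw [← this]
  exact hg.integrableOn_Icc

/-- The square root of the affine image of `t` in the unit interval. -/
def unitSqrt (a b t : ℝ) : ℝ := √((t - a) / (b - a))

lemma continuous_unitSqrt (a b : ℝ) : Continuous (unitSqrt a b) := by
  unfold unitSqrt
  fun_prop

/-- The functional of the symmetrised measure obtained from `μ` by the substitution
`t ↦ a + (b - a) * t ^ 2`. -/
def symmFunctional (a b : ℝ) (μ : Measure ℝ) : ℝ[X] →ₗ[ℝ] ℝ :=
  momentFunctional fun n => ∫ t, (unitSqrt a b t ^ n + (-unitSqrt a b t) ^ n) / 2 ∂μ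

lemma symmFunctional_apply {a b : ℝ} {μ : Measure ℝ} [IsFiniteMeasure μ]
    (hμ : μ (Set.Icc a b)ᶜ = 0) (f : ℝ[X]) : symmFunctional a b μ f =
      ∫ t, (f.eval (unitSqrt a b t) + f.eval (-unitSqrt a b t)) / 2 ∂μ := by
  have hc := continuous_unitSqrt a b
  induction f using Polynomial.induction_on' with
  | add p q hp hq =>
    rw [map_add, hp, hq, ← integral_add (integrable_of_continuous hμ (by fun_prop))
      (integrable_of_continuous hμ (by fun_prop))]
    congr 1 with t
    simp only [Polynomial.eval_add]
    ring
  | monomial n r =>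
    rw [← Polynomial.C_mul_X_pow_eq_monomial, map_C_mul, symmFunctional, momentFunctional_X_pow,
      ← integral_const_mul]
    congr 1 with t
    simp only [Polynomial.eval_mul, Polynomial.eval_C, Polynomial.eval_pow, Polynomial.eval_X]
    ring

lemma unitSqrt_mem {a b t : ℝ} (hab : a < b) (ht : t ∈ Set.Icc a b) :
    unitSqrt a b t ^ 2 = (t - a) / (b - a) ∧ unitSqrt a b t ^ 2 ≤ 1 := by
  have hba := sub_pos.2 hab
  have : unitSqrt a b t ^ 2 = (t - a) / (b - a) :=
    Real.sq_sqrt (div_nonneg (by linarith [ht.1]) hba.le)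
  exact ⟨this, this ▸ (div_le_one hba).2 (by linarith [ht.2])⟩

lemma symmFunctional_nonneg {a b : ℝ} (hab : a < b) {μ : Measure ℝ} [IsFiniteMeasure μ]
    (hμ : μ (Set.Icc a b)ᶜ = 0) {f : ℝ[X]} (hf : ∀ s : ℝ, s ^ 2 ≤ 1 → 0 ≤ f.eval s) :
    0 ≤ symmFunctional a b μ f := by
  rw [symmFunctional_apply hμ]
  refine integral_nonneg_of_ae ?_
  filter_upwards [show ∀ᵐ t ∂μ, t ∈ Set.Icc a b from hμ] with t ht
  have h := (unitSqrt_mem hab ht).2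
  exact div_nonneg (add_nonneg (hf _ h) (hf _ (by simpa using h))) two_pos.le

lemma symmFunctional_intervalPoly {a b : ℝ} (hab : a < b) {μ : Measure ℝ} [IsFiniteMeasure μ]
    (hμ : μ (Set.Icc a b)ᶜ = 0) (i : ℕ) :
    symmFunctional a b μ (intervalPoly a b ^ i) = ∫ t, t ^ i ∂μ := by
  rw [symmFunctional_apply hμ]
  refine integral_congr_ae ?_
  filter_upwards [show ∀ᵐ t ∂μ, t ∈ Set.Icc a b from hμ] with t ht
  have h := (unitSqrt_mem hab ht).1
  have hba := (sub_pos.2 hab).ne'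
  have : a + (b - a) * unitSqrt a b t ^ 2 = t := by rw [h]; field_simp; ring
  simp [intervalPoly, this]

/-- The `(j + 1)`-st moment of a measure on `[a, b]` is between the extremal values determined by
the first `j` moments. -/
lemma moment_bounds {a b : ℝ} (hab : a < b) {μ : Measure ℝ} [IsFiniteMeasure μ]
    (hμ : μ (Set.Icc a b)ᶜ = 0) {x : ℕ → ℝ} {j : ℕ}
    (h : ∀ i ≤ j, ∫ t, t ^ i ∂μ = canonMoment a b x i) :
    canonMoment a b x (j + 1) - (b - a) ^ (j + 1) * canonRange x j * x j ≤ ∫ t, t ^ (j + 1) ∂μ ∧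
    ∫ t, t ^ (j + 1) ∂μ ≤
      canonMoment a b x (j + 1) + (b - a) ^ (j + 1) * canonRange x j * (1 - x j) := by
  set L := symmFunctional a b μ with hL
  set L' := momentFunctional (fun n => pathSum (zeta x) n 0) with hL'
  have hagree : ∀ n < 2 * (j + 1), L (X ^ n) = L' (X ^ n) := by
    intro n hn
    rcases Nat.even_or_odd' n with ⟨l, rfl | rfl⟩
    · refine functional_even_eq (j := j) hab (fun i hi => ?_) (by omega)
      rw [hL, symmFunctional_intervalPoly hab hμ, h i hi, canonMoment]
    · rw [hL, hL', symmFunctional, momentFunctional_X_pow, momentFunctional_X_pow,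
        pathSum_eq_zero_of_odd _ _ _ (by omega)]
      simp [Odd.neg_pow (⟨l, rfl⟩ : Odd (2 * l + 1))]
  have hlead := functional_sub_eq hagree (intervalPoly_pow_natDegree_le a b (j + 1))
  rw [intervalPoly_pow_coeff, hL, symmFunctional_intervalPoly hab hμ, ← hL,
    show L' (intervalPoly a b ^ (j + 1)) = canonMoment a b x (j + 1) from rfl] at hlead
  set δ := L (X ^ (2 * (j + 1))) - L' (X ^ (2 * (j + 1)))
  have hpos : 0 < (b - a) ^ (j + 1) := pow_pos (sub_pos.2 hab) _
  have hP := orthoPoly_monic (zeta x) (j + 1)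
  have hQ : (kernelPoly x j).Monic := orthoPoly_monic _ _
  have hPd := orthoPoly_natDegree (zeta x) (j + 1)
  have hQd : (kernelPoly x j).natDegree = j := orthoPoly_natDegree _ _
  have hlow : -(canonRange x j * x j) ≤ δ := by
    have hd : (orthoPoly (zeta x) (j + 1) ^ 2).natDegree = 2 * (j + 1) := by
      rw [hP.natDegree_pow, hPd]
    have h1 := functional_sub_eq hagree hd.le
    have hc : (orthoPoly (zeta x) (j + 1) ^ 2).coeff (2 * (j + 1)) = 1 := by
      rw [← hd]; exact (hP.pow 2).coeff_natDegree
    rw [hc, one_mul, functional_sq_orthoPoly] at h1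
    have h2 : 0 ≤ L (orthoPoly (zeta x) (j + 1) ^ 2) :=
      symmFunctional_nonneg hab hμ fun s _ => by rw [Polynomial.eval_pow]; positivity
    linarith
  have hupp : δ ≤ canonRange x j * (1 - x j) := by
    have h1 : (X ^ 2 - 1 : ℝ[X]).Monic := Polynomial.monic_X_pow_sub_C 1 two_ne_zero
    have hm := h1.mul (hQ.pow 2)
    have hd : ((X ^ 2 - 1) * kernelPoly x j ^ 2).natDegree = 2 * (j + 1) := by
      rw [h1.natDegree_mul (hQ.pow 2),
        hQ.natDegree_pow, hQd, ← map_one C, Polynomial.natDegree_X_pow_sub_C]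
      ring
    have h1 := functional_sub_eq hagree hd.le
    have hc : ((X ^ 2 - 1) * kernelPoly x j ^ 2).coeff (2 * (j + 1)) = 1 := by
      rw [← hd]; exact hm.coeff_natDegree
    have hneg : (X ^ 2 - 1) * kernelPoly x j ^ 2 = -((1 - X ^ 2) * kernelPoly x j ^ 2) := by ring
    rw [hc, one_mul, hneg, map_neg, map_neg, functional_sq_kernelPoly] at h1
    have h2 : 0 ≤ L ((1 - X ^ 2) * kernelPoly x j ^ 2) :=
      symmFunctional_nonneg hab hμ fun s hs => by
        simp only [Polynomial.eval_mul, Polynomial.eval_sub, Polynomial.eval_one,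
          Polynomial.eval_pow, Polynomial.eval_X]
        exact mul_nonneg (sub_nonneg.2 hs) (sq_nonneg _)
    linarith
  constructor
  · nlinarith [mul_le_mul_of_nonneg_left hlow hpos.le]
  · nlinarith [mul_le_mul_of_nonneg_left hupp hpos.le]

/-- Extension of a finite sequence by zero. -/
def extendZero {n : ℕ} (v : Fin n → ℝ) (i : ℕ) : ℝ := if h : i < n then v ⟨i, h⟩ else 0

@[simp] lemma extendZero_val {n : ℕ} (v : Fin n → ℝ) (i : Fin n) : extendZero v i = v i := by
  simp [extendZero]

lemma extendZero_of_le {n : ℕ} (v : Fin n → ℝ) {i : ℕ} (h : n ≤ i) : extendZero v i = 0 := by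
  simp [extendZero, h]

/-- The action on sequences of the Jacobi matrix with off-diagonal entries `√(z i)`. -/
def jacobiSeq (z V : ℕ → ℝ) : ℕ → ℝ
  | 0 => √(z 0) * V 1
  | h + 1 => √(z (h + 1)) * V (h + 2) + √(z h) * V h

/-- The Jacobi matrix of size `N + 1` with off-diagonal entries `√(z i)`. -/
def jacobiMap (z : ℕ → ℝ) (N : ℕ) :
    EuclideanSpace ℝ (Fin (N + 1)) →ₗ[ℝ] EuclideanSpace ℝ (Fin (N + 1)) where
  toFun v := WithLp.toLp 2 fun h => jacobiSeq z (extendZero v.ofLp) h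
  map_add' v w := by
    have : extendZero (v + w).ofLp = extendZero v.ofLp + extendZero w.ofLp := by
      ext i; by_cases h : i < N + 1 <;> simp [extendZero, h]
    ext ⟨h, hh⟩
    simp only [this, PiLp.add_apply]
    cases h <;> simp [jacobiSeq] <;> ring
  map_smul' r v := by
    have : extendZero (r • v).ofLp = r • extendZero v.ofLp := by
      ext i; by_cases h : i < N + 1 <;> simp [extendZero, h]
    ext ⟨h, hh⟩
    simp only [this, PiLp.smul_apply]
    cases h <;> simp [jacobiSeq] <;> ring

lemma extendZero_jacobiMap (z : ℕ → ℝ) (N : ℕ) (v : EuclideanSpace ℝ (Fin (N + 1))) {h : ℕ}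
    (hh : h ≤ N) : extendZero (jacobiMap z N v).ofLp h = jacobiSeq z (extendZero v.ofLp) h := by
  simp [extendZero, jacobiMap, Nat.lt_succ_of_le hh]

lemma inner_eq_sum_range {N : ℕ} (v w : EuclideanSpace ℝ (Fin (N + 1))) :
    inner ℝ v w = ∑ h ∈ Finset.range (N + 1), extendZero v.ofLp h * extendZero w.ofLp h := by
  rw [Finset.sum_range, PiLp.inner_apply]
  refine Finset.sum_congr rfl fun i _ => ?_
  rw [extendZero_val, extendZero_val]
  simp [mul_comm]

lemma inner_jacobiMap (z : ℕ → ℝ) (N : ℕ) (v w : EuclideanSpace ℝ (Fin (N + 1))) :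
    inner ℝ v (jacobiMap z N w) = ∑ h ∈ Finset.range N, √(z h) *
      (extendZero v.ofLp h * extendZero w.ofLp (h + 1) +
        extendZero v.ofLp (h + 1) * extendZero w.ofLp h) := by
  rw [inner_eq_sum_range, Finset.sum_congr rfl fun h hh => by
    rw [extendZero_jacobiMap z N w (Nat.lt_succ_iff.1 (Finset.mem_range.1 hh))]]
  have key : ∀ (V W : ℕ → ℝ) (n : ℕ), ∑ h ∈ Finset.range (n + 1), V h * jacobiSeq z W h =
      ∑ h ∈ Finset.range n, √(z h) * (V h * W (h + 1) + V (h + 1) * W h) +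
        V n * √(z n) * W (n + 1) := by
    intro V W n
    induction n with
    | zero => simp [jacobiSeq]; ring
    | succ n ih => rw [Finset.sum_range_succ, ih, Finset.sum_range_succ, jacobiSeq]; ring
  rw [key, extendZero_of_le w.ofLp le_rfl, mul_zero, add_zero]

lemma jacobiMap_isSymmetric (z : ℕ → ℝ) (N : ℕ) : (jacobiMap z N).IsSymmetric := by
  intro v w
  rw [real_inner_comm, inner_jacobiMap, inner_jacobiMap]
  exact Finset.sum_congr rfl fun h _ => by ring

lemma pathSum_eq_zero_of_gt {z : ℕ → ℝ} {N : ℕ} (hz : ∀ i, N ≤ i → z i = 0) (n h : ℕ)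
    (hh : N < h) : pathSum z n h = 0 := by
  obtain ⟨h, rfl⟩ : ∃ m, h = m + 1 := ⟨h - 1, by omega⟩
  induction n generalizing h with
  | zero => simp [pathSum]
  | succ n ih => simp [pathSum, ih (h + 1) (by omega), hz h (by omega)]

lemma pathSum_eq_jacobiMap {z : ℕ → ℝ} {N : ℕ} (hz0 : ∀ i, 0 ≤ z i) (hz : ∀ i, N ≤ i → z i = 0)
    (n h : ℕ) : pathSum z n h = (∏ i ∈ Finset.range h, √(z i)) *
      extendZero ((jacobiMap z N ^ n) (EuclideanSpace.single 0 1)).ofLp h := by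
  induction n generalizing h with
  | zero =>
    cases h with
    | zero => simp [pathSum, extendZero]
    | succ h => by_cases hh : h < N <;> simp [pathSum, extendZero, hh]
  | succ n ih =>
    rw [pow_succ', Module.End.mul_apply]
    rcases Nat.lt_or_ge N h with hh | hh
    · rw [pathSum_eq_zero_of_gt hz _ _ hh,
        Finset.prod_eq_zero (Finset.mem_range.2 hh) (by rw [hz N le_rfl, Real.sqrt_zero]), zero_mul]
    · rw [extendZero_jacobiMap _ _ _ hh]
      cases h with
      | zero => simp [pathSum, jacobiSeq, ih 1]
      | succ h =>
        rw [pathSum, ih, ih, jacobiSeq]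
        simp only [Finset.prod_range_succ]
        have hsq := Real.mul_self_sqrt (hz0 h)
        set y := √(z h)
        rw [← hsq]
        ring

lemma sum_coCanon_add (x U : ℕ → ℝ) (N : ℕ) :
    ∑ h ∈ Finset.range N, (coCanon x h * U h ^ 2 + x h * U (h + 1) ^ 2) + coCanon x N * U N ^ 2 =
      ∑ h ∈ Finset.range (N + 1), U h ^ 2 := by
  induction N with
  | zero => simp [coCanon]
  | succ N ih =>
    rw [Finset.sum_range_succ, Finset.sum_range_succ _ (N + 1), ← ih, coCanon]
    ring

lemma coCanon_nonneg {x : ℕ → ℝ} (hx : ∀ i, x i ∈ Set.Icc (0 : ℝ) 1) (i : ℕ) :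
    0 ≤ coCanon x i := by
  cases i with
  | zero => exact zero_le_one
  | succ i => exact sub_nonneg.2 (hx i).2

lemma abs_inner_jacobiMap_le {x : ℕ → ℝ} (hx : ∀ i, x i ∈ Set.Icc (0 : ℝ) 1) (N : ℕ)
    (v : EuclideanSpace ℝ (Fin (N + 1))) :
    |inner ℝ v (jacobiMap (zeta x) N v)| ≤ inner ℝ v v := by
  rw [inner_jacobiMap, inner_eq_sum_range]
  set U := extendZero v.ofLp
  have h1 := sum_coCanon_add x U N
  simp only [← sq]
  refine (Finset.abs_sum_le_sum_abs _ _).trans (le_trans (Finset.sum_le_sum (g := fun h =>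
    coCanon x h * U h ^ 2 + x h * U (h + 1) ^ 2) fun h _ => ?_) ?_)
  · have hq := coCanon_nonneg hx h
    have e1 := Real.sq_sqrt hq
    have e2 := Real.sq_sqrt (hx h).1
    rw [zeta, Real.sqrt_mul hq, abs_le]
    constructor
    · nlinarith [sq_nonneg (√(coCanon x h) * U h + √(x h) * U (h + 1))]
    · nlinarith [sq_nonneg (√(coCanon x h) * U h - √(x h) * U (h + 1))]
  · have := mul_nonneg (coCanon_nonneg hx N) (sq_nonneg (U N))
    linarith

/-- A finitely supported representation of the moment functional of a terminating sequence of
canonical moments. -/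
lemma exists_quadrature {x : ℕ → ℝ} (hx : ∀ i, x i ∈ Set.Icc (0 : ℝ) 1) {N : ℕ}
    (hN : ∀ i, N ≤ i → x i = 0) : ∃ l w : Fin (N + 1) → ℝ, (∀ i, l i ^ 2 ≤ 1) ∧ (∀ i, 0 ≤ w i) ∧
      ∀ n, pathSum (zeta x) n 0 = ∑ i, w i * l i ^ n := by
  have hfin : Module.finrank ℝ (EuclideanSpace ℝ (Fin (N + 1))) = N + 1 := by simp
  set T := jacobiMap (zeta x) N
  have hT : T.IsSymmetric := jacobiMap_isSymmetric _ _
  set u := hT.eigenvectorBasis hfin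
  set l := hT.eigenvalues hfin
  set e : EuclideanSpace ℝ (Fin (N + 1)) := EuclideanSpace.single 0 1
  have hTu : ∀ i, T (u i) = l i • u i := fun i => hT.apply_eigenvectorBasis hfin i
  refine ⟨l, fun i => inner ℝ (u i) e ^ 2, fun i => ?_, fun i => sq_nonneg _, fun n => ?_⟩
  · have h := abs_inner_jacobiMap_le hx N (u i)
    rw [show jacobiMap (zeta x) N (u i) = l i • u i from hTu i, inner_smul_right,
      real_inner_self_eq_norm_sq, u.norm_eq_one] at h
    rw [sq_le_one_iff_abs_le_one]
    simpa using h
  · have hpow : ∀ i, inner ℝ (u i) ((T ^ n) e) = l i ^ n * inner ℝ (u i) e := by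
      intro i
      induction n with
      | zero => simp
      | succ n ih =>
        rw [pow_succ', Module.End.mul_apply, ← hT, hTu, inner_smul_left, ih]
        simp
        ring
    have hz0 : ∀ i, 0 ≤ zeta x i := fun i => mul_nonneg (coCanon_nonneg hx i) (hx i).1
    have hz : ∀ i, N ≤ i → zeta x i = 0 := fun i hi => by simp [zeta, hN i hi]
    rw [pathSum_eq_jacobiMap hz0 hz]
    have h0 : extendZero ((T ^ n) e).ofLp 0 = inner ℝ e ((T ^ n) e) := by
      simp [e, extendZero, EuclideanSpace.inner_single_left]
    rw [Finset.prod_range_zero, one_mul, h0, ← u.sum_inner_mul_inner]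
    refine Finset.sum_congr rfl fun i _ => ?_
    rw [hpow, real_inner_comm]
    ring

lemma exists_measure_of_terminating {a b : ℝ} (hab : a < b) {x : ℕ → ℝ}
    (hx : ∀ i, x i ∈ Set.Icc (0 : ℝ) 1) {N : ℕ} (hN : ∀ i, N ≤ i → x i = 0) :
    ∃ μ : Measure ℝ, IsProbabilityMeasure μ ∧ μ (Set.Icc a b)ᶜ = 0 ∧
      ∀ i, ∫ t, t ^ i ∂μ = canonMoment a b x i := by
  obtain ⟨l, w, hl, hw, hlw⟩ := exists_quadrature hx hN
  have hba := sub_pos.2 hab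
  have hsum : ∑ i, w i = 1 := by simpa [pathSum] using (hlw 0).symm
  have hfun : ∀ f : ℝ[X], momentFunctional (fun n => pathSum (zeta x) n 0) f =
      ∑ i, w i * f.eval (l i) := by
    intro f
    induction f using Polynomial.induction_on' with
    | add p q hp hq => simp [hp, hq, mul_add, Finset.sum_add_distrib]
    | monomial n r =>
      rw [← Polynomial.C_mul_X_pow_eq_monomial, map_C_mul, momentFunctional_X_pow, hlw,
        Finset.mul_sum]
      refine Finset.sum_congr rfl fun i _ => ?_
      simp
      ring
  refine ⟨∑ i, ENNReal.ofReal (w i) • Measure.dirac (a + (b - a) * l i ^ 2), ⟨?_⟩, ?_, fun i => ?_⟩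
  · rw [Measure.finsetSum_apply]
    simp only [Measure.smul_apply, measure_univ, smul_eq_mul, mul_one]
    rw [← ENNReal.ofReal_sum_of_nonneg fun i _ => hw i, hsum, ENNReal.ofReal_one]
  · rw [Measure.finsetSum_apply]
    refine Finset.sum_eq_zero fun i _ => ?_
    have : a + (b - a) * l i ^ 2 ∈ Set.Icc a b :=
      ⟨by nlinarith [sq_nonneg (l i)], by nlinarith [hl i]⟩
    rw [Measure.smul_apply, Measure.dirac_apply' _ measurableSet_Icc.compl,
      Set.indicator_of_notMem (by simpa using this), smul_zero]
  · rw [integral_finsetSum_measure fun i _ =>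
      (integrable_dirac (by simp)).smul_measure ENNReal.ofReal_ne_top, canonMoment, hfun]
    refine Finset.sum_congr rfl fun m _ => ?_
    rw [integral_smul_measure, integral_dirac, ENNReal.toReal_ofReal (hw m)]
    simp [intervalPoly]

lemma exists_measure {a b : ℝ} (hab : a < b) {x : ℕ → ℝ} {N : ℕ}
    (hx : ∀ i < N, x i ∈ Set.Icc (0 : ℝ) 1) :
    ∃ μ : Measure ℝ, IsProbabilityMeasure μ ∧ μ (Set.Icc a b)ᶜ = 0 ∧
      ∀ i ≤ N, ∫ t, t ^ i ∂μ = canonMoment a b x i := by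
  obtain ⟨μ, h1, h2, h3⟩ := exists_measure_of_terminating hab (N := N)
    (x := fun i => if i < N then x i else 0)
    (fun i => by
      by_cases h : i < N
      · simpa [h] using hx i h
      · simp [h])
    (fun i hi => by simp [hi])
  refine ⟨μ, h1, h2, fun i hi => ?_⟩
  rw [h3 i]
  exact canonMoment_congr (j := N) (fun m hm => by simp [hm]) hi

/-- The map sending canonical moments to moments on `[a, b]`. -/
def canonMap (a b : ℝ) (n : ℕ) (x : Fin n → ℝ) (j : Fin n) : ℝ :=
  canonMoment a b (extendZero x) (j + 1)

/-- The open unit cube. -/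
def openCube (n : ℕ) : Set (Fin n → ℝ) := Set.univ.pi fun _ => Set.Ioo 0 1

lemma isOpen_openCube (n : ℕ) : IsOpen (openCube n) :=
  isOpen_set_pi Set.finite_univ fun _ _ => isOpen_Ioo

lemma canonMoment_zero (a b : ℝ) (x : ℕ → ℝ) : canonMoment a b x 0 = 1 := by
  rw [canonMoment, pow_zero, ← pow_zero X, momentFunctional_X_pow, pathSum]

lemma canonRange_pos {x : ℕ → ℝ} {j : ℕ} (h : ∀ i < j, x i ∈ Set.Ioo (0 : ℝ) 1) :
    0 < canonRange x j :=
  Finset.prod_pos fun i hi => by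
    have := h i (Finset.mem_range.1 hi)
    exact mul_pos this.1 (sub_pos.2 this.2)

section momentSection

variable {a b : ℝ} {n : ℕ} {v : Fin n → ℝ} {x : ℕ → ℝ} {j : ℕ}

lemma mem_momentSection_bounds (hab : a < b) (hj : j ≤ n)
    (hv : ∀ i : Fin n, (i : ℕ) < j → v i = canonMoment a b x (i + 1)) {m : ℝ}
    (hm : m ∈ momentSection a b v (j + 1)) :
    canonMoment a b x (j + 1) - (b - a) ^ (j + 1) * canonRange x j * x j ≤ m ∧
      m ≤ canonMoment a b x (j + 1) + (b - a) ^ (j + 1) * canonRange x j * (1 - x j) := by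
  obtain ⟨μ, hp, hμ, hi, rfl⟩ := hm
  refine moment_bounds hab hμ fun i hij => ?_
  cases i with
  | zero => simp [canonMoment_zero]
  | succ i => rw [← hv ⟨i, by omega⟩ (by simp; omega), ← hi ⟨i, by omega⟩ (by simp; omega)]

lemma mem_momentSection (hab : a < b)
    (hv : ∀ i : Fin n, (i : ℕ) < j → v i = canonMoment a b x (i + 1))
    (hx : ∀ i < j, x i ∈ Set.Icc (0 : ℝ) 1) {p : ℝ} (hp : p ∈ Set.Icc (0 : ℝ) 1) :
    canonMoment a b x (j + 1) + (b - a) ^ (j + 1) * canonRange x j * (p - x j) ∈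
      momentSection a b v (j + 1) := by
  have hagree : ∀ i < j, x i = Function.update x j p i := fun i hi => by
    rw [Function.update_of_ne hi.ne]
  obtain ⟨μ, h1, h2, h3⟩ := exists_measure hab (x := Function.update x j p) (N := j + 1)
    (fun i hi => by
      rcases eq_or_ne i j with rfl | h
      · simpa using hp
      · simpa [Function.update_of_ne h] using hx i (by omega))
  refine ⟨μ, h1, h2, fun i hi => ?_, ?_⟩
  · rw [h3 _ (by omega), hv i (by omega)]
    exact (canonMoment_congr hagree (by omega)).symm
  · have := canonMoment_succ_sub (a := a) (b := b) hagree
    rw [Function.update_self] at this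
    rw [h3 _ le_rfl]
    linarith

lemma csInf_momentSection (hab : a < b) (hj : j ≤ n)
    (hv : ∀ i : Fin n, (i : ℕ) < j → v i = canonMoment a b x (i + 1))
    (hx : ∀ i < j, x i ∈ Set.Icc (0 : ℝ) 1) : sInf (momentSection a b v (j + 1)) =
      canonMoment a b x (j + 1) - (b - a) ^ (j + 1) * canonRange x j * x j := by
  refine IsLeast.csInf_eq ⟨?_, fun m hm => (mem_momentSection_bounds hab hj hv hm).1⟩
  convert mem_momentSection hab hv hx (p := 0) (by simp) using 1
  ring

lemma csSup_momentSection (hab : a < b) (hj : j ≤ n)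
    (hv : ∀ i : Fin n, (i : ℕ) < j → v i = canonMoment a b x (i + 1))
    (hx : ∀ i < j, x i ∈ Set.Icc (0 : ℝ) 1) : sSup (momentSection a b v (j + 1)) =
      canonMoment a b x (j + 1) + (b - a) ^ (j + 1) * canonRange x j * (1 - x j) :=
  IsGreatest.csSup_eq ⟨mem_momentSection hab hv hx (by simp),
    fun _ hm => (mem_momentSection_bounds hab hj hv hm).2⟩

end momentSection

lemma extendZero_mem {n : ℕ} {x : Fin n → ℝ} (hx : x ∈ openCube n) {i : ℕ} (hi : i < n) :
    extendZero x i ∈ Set.Ioo (0 : ℝ) 1 := by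
  simpa [extendZero, hi] using hx ⟨i, hi⟩ (Set.mem_univ _)

lemma canCompact_canonMap {a b : ℝ} (hab : a < b) {n : ℕ} {x : Fin n → ℝ} (hx : x ∈ openCube n)
    (j : Fin n) : canCompact a b (canonMap a b n x) j = x j := by
  have hx' : ∀ i < (j : ℕ), extendZero x i ∈ Set.Ioo (0 : ℝ) 1 := fun i hi =>
    extendZero_mem hx (hi.trans j.2)
  have hs : 0 < (b - a) ^ ((j : ℕ) + 1) * canonRange (extendZero x) j :=
    mul_pos (pow_pos (sub_pos.2 hab) _) (canonRange_pos hx')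
  have hx'' := fun i hi => Set.Ioo_subset_Icc_self (hx' i hi)
  have hv : ∀ i : Fin n, (i : ℕ) < j →
      canonMap a b n x i = canonMoment a b (extendZero x) (i + 1) :=
    fun _ _ => rfl
  rw [canCompact, csInf_momentSection hab j.2.le hv hx'', csSup_momentSection hab j.2.le hv hx'',
    canonMap, extendZero_val, div_eq_iff (by ring_nf; ring_nf at hs; exact hs.ne')]
  ring

lemma injOn_canonMap {a b : ℝ} (hab : a < b) (n : ℕ) :
    Set.InjOn (canonMap a b n) (openCube n) := fun x hx y hy h => by
  ext j
  rw [← canCompact_canonMap hab hx, h, canCompact_canonMap hab hy]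

lemma contDiff_extendZero {n : ℕ} (i : ℕ) :
    ContDiff ℝ 1 fun x : Fin n → ℝ => extendZero x i := by
  by_cases h : i < n
  · simp only [extendZero, h, dite_true]; fun_prop
  · simp only [extendZero, h, dite_false]; fun_prop

lemma contDiff_zeta {n : ℕ} (i : ℕ) :
    ContDiff ℝ 1 fun x : Fin n → ℝ => zeta (extendZero x) i := by
  have := contDiff_extendZero (n := n)
  cases i with
  | zero => simpa [zeta, coCanon] using this 0
  | succ i => exact (contDiff_const.sub (this i)).mul (this (i + 1))

lemma contDiff_pathSum {n : ℕ} (m h : ℕ) :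
    ContDiff ℝ 1 fun x : Fin n → ℝ => pathSum (zeta (extendZero x)) m h := by
  induction m generalizing h with
  | zero => cases h <;> simp only [pathSum] <;> exact contDiff_const
  | succ m ih =>
    cases h with
    | zero => simpa only [pathSum] using ih 1
    | succ h =>
      simp only [pathSum]
      exact (ih (h + 2)).add ((contDiff_zeta h).mul (ih h))

lemma contDiff_canonMap (a b : ℝ) (n : ℕ) : ContDiff ℝ 1 (canonMap a b n) := by
  rw [contDiff_pi]
  intro j
  simp only [canonMap, canonMoment, momentFunctional_apply, Polynomial.sum]
  exact ContDiff.sum fun i _ => (contDiff_pathSum i 0).mul contDiff_const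

lemma extendZero_add_single {n : ℕ} (x : Fin n → ℝ) (j : Fin n) (t : ℝ) {i : ℕ} (hi : i < j) :
    extendZero x i = extendZero (x + t • Pi.single j 1) i := by
  have h : i < n := hi.trans j.2
  have hne : (⟨i, h⟩ : Fin n) ≠ j := fun e => by simp [← e] at hi
  simp [extendZero, h, hne]

lemma det_fderiv_canonMap (a b : ℝ) (n : ℕ) (x : Fin n → ℝ) :
    (fderiv ℝ (canonMap a b n) x).det =
      ∏ j : Fin n, ((b - a) ^ ((j : ℕ) + 1) * canonRange (extendZero x) j) := by
  have hd : HasFDerivAt (canonMap a b n) (fderiv ℝ (canonMap a b n) x) x :=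
    ((contDiff_canonMap a b n).differentiable one_ne_zero x).hasFDerivAt
  have hline : ∀ i j : Fin n, HasDerivAt (fun t : ℝ => canonMap a b n (x + t • Pi.single j 1) i)
      (fderiv ℝ (canonMap a b n) x (Pi.single j 1) i) 0 := fun i j =>
    (hasDerivAt_pi.1 (hd.hasLineDerivAt (Pi.single j 1))) i
  rw [ContinuousLinearMap.det, ← LinearMap.det_toMatrix', Matrix.det_of_isLowerTriangular]
  · refine Finset.prod_congr rfl fun j _ => ?_
    rw [LinearMap.toMatrix'_apply]
    refine (hline j j).unique ?_
    have e : (fun t : ℝ => canonMap a b n (x + t • Pi.single j 1) j) = fun t =>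
        canonMap a b n x j + (b - a) ^ ((j : ℕ) + 1) * canonRange (extendZero x) j * t := by
      ext t
      have := canonMoment_succ_sub (a := a) (b := b) (j := j)
        fun i hi => extendZero_add_single x j t hi
      simp only [extendZero_val, Pi.add_apply, Pi.smul_apply, Pi.single_eq_same] at this
      simp only [canonMap, smul_eq_mul, mul_one] at this ⊢
      linarith
    rw [e]
    simpa using ((hasDerivAt_id (0 : ℝ)).const_mul
      ((b - a) ^ ((j : ℕ) + 1) * canonRange (extendZero x) j)).const_add (canonMap a b n x j)
  · intro i j hij
    rw [LinearMap.toMatrix'_apply]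
    refine (hline i j).unique ?_
    have e : (fun t : ℝ => canonMap a b n (x + t • Pi.single j 1) i) =
        fun _ => canonMap a b n x i := by
      ext t
      exact (canonMoment_congr (j := i + 1) (fun m hm => extendZero_add_single x j t
        (by have : i < j := hij; omega)) le_rfl).symm
    rw [e]
    exact hasDerivAt_const _ _

lemma det_fderiv_canonMap_pos {a b : ℝ} (hab : a < b) {n : ℕ} {x : Fin n → ℝ}
    (hx : x ∈ openCube n) : 0 < (fderiv ℝ (canonMap a b n) x).det := by
  rw [det_fderiv_canonMap]
  exact Finset.prod_pos fun j _ => mul_pos (pow_pos (sub_pos.2 hab) _)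
    (canonRange_pos fun i hi => extendZero_mem hx (hi.trans j.2))

lemma isOpen_image_canonMap {a b : ℝ} (hab : a < b) (n : ℕ) :
    IsOpen (canonMap a b n '' openCube n) := by
  rw [isOpen_iff_mem_nhds]
  rintro _ ⟨x, hx, rfl⟩
  have hs := (contDiff_canonMap a b n).contDiffAt.hasStrictFDerivAt (x := x) one_ne_zero
  have hdet := (det_fderiv_canonMap_pos hab hx).ne'
  rw [← ContinuousLinearMap.coe_toContinuousLinearEquivOfDetNeZero _ hdet] at hs
  rw [← hs.map_nhds_eq_of_equiv]
  exact image_mem_map ((isOpen_openCube n).mem_nhds hx)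

lemma canonMap_mem_momentSpace {a b : ℝ} (hab : a < b) {n : ℕ} {x : Fin n → ℝ}
    (hx : x ∈ openCube n) : canonMap a b n x ∈ momentSpace (Set.Icc a b) n := by
  obtain ⟨μ, h1, h2, h3⟩ := exists_measure hab (x := extendZero x) (N := n)
    fun i hi => Set.Ioo_subset_Icc_self (extendZero_mem hx hi)
  exact ⟨μ, h1, h2, fun j => integrable_of_continuous h2 (by fun_prop),
    fun j => (h3 _ (by omega)).symm⟩

lemma momentSpace_mem_momentSection {a b : ℝ} {n : ℕ} {v w : Fin n → ℝ} {j : Fin n}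
    (hw : w ∈ momentSpace (Set.Icc a b) n) (hvw : ∀ i < j, w i = v i) :
    w j ∈ momentSection a b v (j + 1) := by
  obtain ⟨μ, h1, h2, -, h3⟩ := hw
  exact ⟨μ, h1, h2, fun i hi => by rw [← h3 i, hvw i (by omega)], h3 j⟩

lemma exists_canon_of_mem_interior {a b : ℝ} (hab : a < b) {n : ℕ} {v : Fin n → ℝ}
    (hv : v ∈ interior (momentSpace (Set.Icc a b) n)) (j : ℕ) (hj : j ≤ n) :
    ∃ x : ℕ → ℝ, (∀ i < j, x i ∈ Set.Ioo (0 : ℝ) 1) ∧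
      ∀ i : Fin n, (i : ℕ) < j → v i = canonMoment a b x (i + 1) := by
  induction j with
  | zero => exact ⟨0, by simp, by simp⟩
  | succ j ih =>
    obtain ⟨x, hx, hvx⟩ := ih (by omega)
    set J : Fin n := ⟨j, hj⟩
    set s := (b - a) ^ (j + 1) * canonRange x j
    have hs : 0 < s := mul_pos (pow_pos (sub_pos.2 hab) _) (canonRange_pos hx)
    have hev : ∀ᶠ t in 𝓝 (0 : ℝ),
        Function.update v J (v J + t) ∈ momentSpace (Set.Icc a b) n := by
      have hc : Continuous fun t : ℝ => Function.update v J (v J + t) := by fun_prop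
      refine hc.continuousAt.eventually_mem (s := momentSpace (Set.Icc a b) n) ?_
      simpa using mem_interior_iff_mem_nhds.1 hv
    have hbd : ∀ t, Function.update v J (v J + t) ∈ momentSpace (Set.Icc a b) n →
        canonMoment a b x (j + 1) - s * x j ≤ v J + t ∧
          v J + t ≤ canonMoment a b x (j + 1) + s * (1 - x j) := by
      intro t ht
      have := mem_momentSection_bounds hab J.2.le hvx (momentSpace_mem_momentSection (v := v)
        (j := J) ht fun i hi => Function.update_of_ne hi.ne _ _)
      simpa [Function.update_self] using this
    obtain ⟨t, ht, ht0⟩ :=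
      ((hev.filter_mono (nhdsWithin_le_nhds (s := Set.Iio 0))).and self_mem_nhdsWithin).exists
    obtain ⟨t', ht', ht0'⟩ :=
      ((hev.filter_mono (nhdsWithin_le_nhds (s := Set.Ioi 0))).and self_mem_nhdsWithin).exists
    have h1 := (hbd t ht).1
    have h2 := (hbd t' ht').2
    replace ht0 : t < 0 := ht0
    replace ht0' : 0 < t' := ht0'
    set p := x j + (v J - canonMoment a b x (j + 1)) / s
    have hp : s * (p - x j) = v J - canonMoment a b x (j + 1) := by
      simp only [p]; field_simp; ring
    have hagree : ∀ i < j, x i = Function.update x j p i := fun i hi => by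
      rw [Function.update_of_ne hi.ne]
    refine ⟨Function.update x j p, fun i hi => ?_, fun i hi => ?_⟩
    · rcases eq_or_ne i j with rfl | h
      · rw [Function.update_self]
        exact ⟨by nlinarith, by nlinarith⟩
      · rw [Function.update_of_ne h]
        exact hx i (by omega)
    · rcases eq_or_ne (i : ℕ) j with h | h
      · have h3 := canonMoment_succ_sub (a := a) (b := b) hagree
        rw [Function.update_self] at h3
        have : i = J := Fin.ext h
        subst this
        change v J = canonMoment a b _ (j + 1)
        linarith
      · rw [hvx i (by omega)]
        exact canonMoment_congr hagree (by omega)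

/-- The interior of the moment space is parametrised by the canonical moments. -/
lemma interior_momentSpace {a b : ℝ} (hab : a < b) (n : ℕ) :
    interior (momentSpace (Set.Icc a b) n) = canonMap a b n '' openCube n := by
  refine Set.Subset.antisymm (fun v hv => ?_) (interior_maximal ?_ (isOpen_image_canonMap hab n))
  · obtain ⟨x, hx, hvx⟩ := exists_canon_of_mem_interior hab hv n le_rfl
    refine ⟨fun i => x i, fun i _ => hx i i.2, funext fun i => ?_⟩
    rw [hvx i i.2]
    exact canonMoment_congr (j := n) (fun m hm => by simp [extendZero, hm]) (by omega)
  · rintro _ ⟨x, hx, rfl⟩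
    exact canonMap_mem_momentSpace hab hx

lemma lintegral_fin_prod {n : ℕ} {f : Fin n → ℝ → ENNReal} (hf : ∀ i, Measurable (f i)) :
    ∫⁻ x : Fin n → ℝ, ∏ i, f i (x i) = ∏ i, ∫⁻ t, f i t := by
  induction n with
  | zero => simp [volume_pi]
  | succ n ih =>
    have hm : Measurable fun x : Fin n → ℝ => ∏ i : Fin n, f i.succ (x i) :=
      Finset.measurable_prod _ fun i _ => (hf i.succ).comp (measurable_pi_apply i)
    rw [← ((volume_preserving_piFinSuccAbove (fun _ : Fin (n + 1) => ℝ) 0).symm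
      _).lintegral_comp_emb (MeasurableEquiv.measurableEmbedding _), Measure.volume_eq_prod]
    simp only [MeasurableEquiv.piFinSuccAbove_symm_apply, Fin.insertNthEquiv, Equiv.coe_fn_mk,
      Fin.prod_univ_succ, Fin.insertNth_zero, Fin.cons_zero, Fin.cons_succ,
      Fin.zero_succAbove, cast_eq]
    rw [lintegral_prod_mul (hf 0).aemeasurable hm.aemeasurable, ih fun i => hf i.succ]

/-- The potential of the `(i + 1)`-st canonical moment. -/
def potential (V1 V2 : ℝ → ℝ) (i : ℕ) : ℝ → ℝ := if i % 2 = 0 then V1 else V2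

/-- The unnormalized density of the `(i + 1)`-st canonical moment of a random point of the `n`-th
moment space. -/
def canonWeight (V : ℝ → ℝ) (n i : ℕ) : ℝ → ENNReal :=
  (Set.Ioo (0 : ℝ) 1).indicator fun p =>
    ENNReal.ofReal (Real.exp (-(n : ℝ) * V p) * (p * (1 - p)) ^ (n - 1 - i))

/-- The normalizing constant of `canonWeight`. -/
def canonMass (V1 V2 : ℝ → ℝ) (n i : ℕ) : ENNReal :=
  ∫⁻ p, canonWeight (potential V1 V2 i) n i p

lemma measurable_canonWeight {V : ℝ → ℝ} (hV : ContinuousOn V (Set.Icc 0 1)) (n i : ℕ) :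
    Measurable (canonWeight V n i) := by
  have hc : ContinuousOn (fun p => ENNReal.ofReal
      (Real.exp (-(n : ℝ) * V p) * (p * (1 - p)) ^ (n - 1 - i))) (Set.Ioo 0 1) := by
    have := hV.mono Set.Ioo_subset_Icc_self
    refine ENNReal.continuous_ofReal.comp_continuousOn ?_
    fun_prop
  rw [canonWeight, ← Set.piecewise_eq_indicator]
  exact hc.measurable_piecewise continuousOn_const measurableSet_Ioo

lemma prod_canonRange (x : ℕ → ℝ) (n : ℕ) : ∏ j ∈ Finset.range n, canonRange x j =
    ∏ i ∈ Finset.range n, (x i * (1 - x i)) ^ (n - 1 - i) := by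
  induction n with
  | zero => simp
  | succ n ih =>
    rw [Finset.prod_range_succ, Finset.prod_range_succ, ih, canonRange, ← Finset.prod_mul_distrib,
      Nat.add_sub_cancel, Nat.sub_self, pow_zero, mul_one]
    refine Finset.prod_congr rfl fun i hi => ?_
    rw [← pow_succ]
    congr 1
    have := Finset.mem_range.1 hi
    omega

lemma prod_canonWeight_eq_zero {n : ℕ} {x : Fin n → ℝ} (hx : x ∉ openCube n)
    (V : Fin n → ℝ → ℝ) (m : Fin n → ℕ) : ∏ i, canonWeight (V i) n (m i) (x i) = 0 := by
  simp only [openCube, Set.mem_univ_pi, not_forall] at hx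
  obtain ⟨i, hi⟩ := hx
  exact Finset.prod_eq_zero (Finset.mem_univ i) (Set.indicator_of_notMem hi _)

lemma det_mul_density {a b : ℝ} (hab : a < b) (V1 V2 : ℝ → ℝ) {n : ℕ} {x : Fin n → ℝ}
    (hx : x ∈ openCube n) : ENNReal.ofReal |(fderiv ℝ (canonMap a b n) x).det| *
        ENNReal.ofReal (canDensityC a b V1 V2 (canonMap a b n x)) =
      ENNReal.ofReal (∏ j : Fin n, (b - a) ^ ((j : ℕ) + 1)) *
        ∏ i : Fin n, canonWeight (potential V1 V2 i) n i (x i) := by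
  have hx' : ∀ i : Fin n, x i ∈ Set.Ioo (0 : ℝ) 1 := fun i => hx i (Set.mem_univ i)
  have hw : ∀ i : Fin n, canonWeight (potential V1 V2 i) n i (x i) = ENNReal.ofReal
      (Real.exp (-(n : ℝ) * potential V1 V2 i (x i)) * (x i * (1 - x i)) ^ (n - 1 - (i : ℕ))) :=
    fun i => Set.indicator_of_mem (hx' i) _
  have hpos : ∀ i : Fin n, 0 < x i * (1 - x i) := fun i =>
    mul_pos (hx' i).1 (sub_pos.2 (hx' i).2)
  have hba := sub_pos.2 hab
  have hR := prod_canonRange (extendZero x) n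
  rw [Finset.prod_range, Finset.prod_range] at hR
  simp only [extendZero_val] at hR
  rw [abs_of_pos (det_fderiv_canonMap_pos hab hx), Finset.prod_congr rfl fun i _ => hw i,
    ← ENNReal.ofReal_prod_of_nonneg
      fun i _ => mul_nonneg (Real.exp_pos _).le (pow_pos (hpos i) _).le,
    ← ENNReal.ofReal_mul (det_fderiv_canonMap_pos hab hx).le,
    ← ENNReal.ofReal_mul (Finset.prod_nonneg fun _ _ => by positivity), det_fderiv_canonMap,
    Finset.prod_mul_distrib, Finset.prod_mul_distrib, hR, canDensityC, ← Real.exp_sum,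
    ← Finset.mul_sum]
  have : ∀ i : Fin n, (if (i : ℕ) % 2 = 0 then V1 (canCompact a b (canonMap a b n x) i)
      else V2 (canCompact a b (canonMap a b n x) i)) = potential V1 V2 i (x i) := by
    intro i
    rw [canCompact_canonMap hab hx, potential]
    split_ifs <;> rfl
  simp only [this]
  congr 1
  ring

lemma setLIntegral_density {a b : ℝ} (hab : a < b) (V1 V2 : ℝ → ℝ) {n : ℕ} {A : Set (Fin n → ℝ)}
    (hA : MeasurableSet A) : (volume.restrict (interior (momentSpace (Set.Icc a b) n))).withDensity
        (fun v => ENNReal.ofReal (canDensityC a b V1 V2 v)) A =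
      ENNReal.ofReal (∏ j : Fin n, (b - a) ^ ((j : ℕ) + 1)) * ∫⁻ x in canonMap a b n ⁻¹' A,
        ∏ i : Fin n, canonWeight (potential V1 V2 i) n i (x i) := by
  have hcube := (isOpen_openCube n).measurableSet
  have hA' : MeasurableSet (canonMap a b n ⁻¹' A) :=
    (contDiff_canonMap a b n).continuous.measurable hA
  rw [withDensity_apply _ hA, ← lintegral_indicator hA, interior_momentSpace hab,
    lintegral_image_eq_lintegral_abs_det_fderiv_mul volume hcube (fun x _ =>
      ((contDiff_canonMap a b n).differentiable one_ne_zero x).hasFDerivAt.hasFDerivWithinAt)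
      (injOn_canonMap hab n), ← lintegral_const_mul' _ _ ENNReal.ofReal_ne_top,
    ← lintegral_indicator hcube, ← lintegral_indicator hA']
  congr 1 with x
  by_cases hx : x ∈ openCube n
  · rw [Set.indicator_of_mem hx]
    by_cases hxA : canonMap a b n x ∈ A
    · rw [Set.indicator_of_mem hxA, Set.indicator_of_mem (by exact hxA), det_mul_density hab _ _ hx]
    · rw [Set.indicator_of_notMem hxA, Set.indicator_of_notMem (by exact hxA), mul_zero]
  · rw [Set.indicator_of_notMem hx]
    refine (Set.indicator_apply_eq_zero.2 fun _ => ?_).symm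
    rw [prod_canonWeight_eq_zero hx, mul_zero]

section Law

variable {a b : ℝ} {V1 V2 : ℝ → ℝ}

lemma continuousOn_potential (hV1 : ContinuousOn V1 (Set.Icc 0 1))
    (hV2 : ContinuousOn V2 (Set.Icc 0 1)) (i : ℕ) :
    ContinuousOn (potential V1 V2 i) (Set.Icc 0 1) := by
  rw [potential]
  split_ifs <;> assumption

/-- Under `ℙ_{n,[a,b],V₁,V₂}` the canonical moments are independent with densities proportional to
`canonWeight`. -/
lemma law_apply (hab : a < b) (hV1 : ContinuousOn V1 (Set.Icc 0 1))
    (hV2 : ContinuousOn V2 (Set.Icc 0 1)) {n : ℕ} {P : Measure (Fin n → ℝ)}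
    (hP : isCompactDist a b V1 V2 n P) :
    ∏ i ∈ Finset.range n, canonMass V1 V2 n i ≠ 0 ∧
    ∏ i ∈ Finset.range n, canonMass V1 V2 n i ≠ ⊤ ∧ ∀ A, MeasurableSet A →
      P A * ∏ i ∈ Finset.range n, canonMass V1 V2 n i = ∫⁻ x in canonMap a b n ⁻¹' A,
        ∏ i : Fin n, canonWeight (potential V1 V2 i) n i (x i) := by
  obtain ⟨hprob, Z, hZ, hP⟩ := hP
  have hform : ∀ A, MeasurableSet A → P A = (ENNReal.ofReal Z)⁻¹ *
      ENNReal.ofReal (∏ j : Fin n, (b - a) ^ ((j : ℕ) + 1)) * ∫⁻ x in canonMap a b n ⁻¹' A,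
        ∏ i : Fin n, canonWeight (potential V1 V2 i) n i (x i) := by
    intro A hA
    conv_lhs => rw [hP]
    rw [Measure.smul_apply, setLIntegral_density hab V1 V2 hA, smul_eq_mul, mul_assoc]
  have htot : ∫⁻ x : Fin n → ℝ, ∏ i : Fin n, canonWeight (potential V1 V2 i) n i (x i) =
      ∏ i ∈ Finset.range n, canonMass V1 V2 n i := by
    rw [Finset.prod_range]
    exact lintegral_fin_prod fun i => measurable_canonWeight (continuousOn_potential hV1 hV2 i) _ _
  set κ := (ENNReal.ofReal Z)⁻¹ * ENNReal.ofReal (∏ j : Fin n, (b - a) ^ ((j : ℕ) + 1))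
  have h1 : κ * ∏ i ∈ Finset.range n, canonMass V1 V2 n i = 1 := by
    have := hform Set.univ MeasurableSet.univ
    rwa [measure_univ, Set.preimage_univ, Measure.restrict_univ, htot, eq_comm] at this
  have hκ : κ ≠ 0 := fun h => by simp [h] at h1
  refine ⟨fun h => by simp [h] at h1, fun h => ?_, fun A hA => ?_⟩
  · rw [h, ENNReal.mul_top hκ] at h1
    exact ENNReal.top_ne_one h1
  · rw [hform A hA, mul_right_comm, h1, one_mul]

lemma prod_split {f : ℕ → ℝ → ENNReal} {k n : ℕ} (hkn : k ≤ n) (x : Fin n → ℝ) :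
    ∏ i : Fin n, f i (x i) = (∏ i ∈ Finset.range k, f i (extendZero x i)) *
      ∏ i ∈ Finset.Ico k n, f i (extendZero x i) := by
  rw [Finset.prod_range_mul_prod_Ico _ hkn, Finset.prod_range]
  simp

/-- The probability of an event is bounded by the supremum of the densities of the first `k`
canonical moments. -/
lemma law_mul_le (hab : a < b) (hV1 : ContinuousOn V1 (Set.Icc 0 1))
    (hV2 : ContinuousOn V2 (Set.Icc 0 1)) {k n : ℕ} (hkn : k ≤ n) {P : Measure (Fin n → ℝ)}
    (hP : isCompactDist a b V1 V2 n P) {A : Set (Fin n → ℝ)} (hA : MeasurableSet A) {B : ENNReal}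
    (hB : ∀ x ∈ openCube n, canonMap a b n x ∈ A →
      ∏ i ∈ Finset.range k, canonWeight (potential V1 V2 i) n i (extendZero x i) ≤ B) :
    P A * ∏ i ∈ Finset.range k, canonMass V1 V2 n i ≤ B := by
  obtain ⟨h0, htop, hlaw⟩ := law_apply hab hV1 hV2 hP
  have hA' : MeasurableSet (canonMap a b n ⁻¹' A) :=
    (contDiff_canonMap a b n).continuous.measurable hA
  rw [← Finset.prod_range_mul_prod_Ico _ hkn] at h0 htop hlaw
  have hR0 := right_ne_zero_of_mul h0
  have hRtop : ∏ i ∈ Finset.Ico k n, canonMass V1 V2 n i ≠ ⊤ := fun h => by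
    rw [h, ENNReal.mul_top (left_ne_zero_of_mul h0)] at htop
    exact htop rfl
  have hmeas := fun i => measurable_canonWeight (continuousOn_potential hV1 hV2 i) n i
  set f : ℕ → ℝ → ENNReal := fun i =>
    if i < k then (Set.Ioo (0 : ℝ) 1).indicator 1 else canonWeight (potential V1 V2 i) n i
  have hf : ∀ i, Measurable (f i) := fun i => by
    by_cases h : i < k
    · simp only [f, h, if_true]; exact measurable_one.indicator measurableSet_Ioo
    · simp only [f, h, if_false]; exact hmeas i
  have hint : ∫⁻ x : Fin n → ℝ, B * ∏ i : Fin n, f i (x i) =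
      B * ∏ i ∈ Finset.Ico k n, canonMass V1 V2 n i := by
    have hm : Measurable fun x : Fin n → ℝ => ∏ i : Fin n, f i (x i) :=
      Finset.measurable_prod _ fun i _ => (hf i).comp (measurable_pi_apply i)
    rw [lintegral_const_mul _ hm, lintegral_fin_prod fun i => hf i,
      ← Finset.prod_range fun i => ∫⁻ t, f i t, ← Finset.prod_range_mul_prod_Ico _ hkn,
      Finset.prod_eq_one (s := Finset.range k), one_mul]
    · congr 1
      refine Finset.prod_congr rfl fun i hi => ?_
      simp only [f, not_lt.2 (Finset.mem_Ico.1 hi).1, if_false, canonMass]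
    · intro i hi
      simp only [f, Finset.mem_range.1 hi, if_true]
      rw [lintegral_indicator_one measurableSet_Ioo]
      simp
  refine (ENNReal.mul_le_mul_iff_left hR0 hRtop).1 ?_
  rw [mul_assoc, hlaw A hA, ← hint, ← lintegral_indicator hA']
  refine lintegral_mono fun x => ?_
  by_cases hxA : x ∈ canonMap a b n ⁻¹' A
  swap
  · rw [Set.indicator_of_notMem hxA]
    exact zero_le
  rw [Set.indicator_of_mem hxA]
  by_cases hx : x ∈ openCube n
  · rw [prod_split (f := fun i => canonWeight (potential V1 V2 i) n i) hkn, prod_split hkn]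
    rw [Finset.prod_eq_one (s := Finset.range k) (f := fun i => f i (extendZero x i)), one_mul]
    · refine mul_le_mul' (hB x hx hxA) (le_of_eq (Finset.prod_congr rfl fun i hi => ?_))
      simp only [f, not_lt.2 (Finset.mem_Ico.1 hi).1, if_false]
    · intro i hi
      have hik := Finset.mem_range.1 hi
      simp only [f, hik, if_true]
      exact Set.indicator_of_mem (extendZero_mem hx (hik.trans_le hkn)) _
  · rw [prod_canonWeight_eq_zero hx]
    exact zero_le

/-- The probability of an event containing a box in the first `k` canonical moments. -/
lemma le_law_mul (hab : a < b) (hV1 : ContinuousOn V1 (Set.Icc 0 1))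
    (hV2 : ContinuousOn V2 (Set.Icc 0 1)) {k n : ℕ} (hkn : k ≤ n) {P : Measure (Fin n → ℝ)}
    (hP : isCompactDist a b V1 V2 n P) {A : Set (Fin n → ℝ)} (hA : MeasurableSet A)
    {J : ℕ → Set ℝ} (hJ : ∀ i, MeasurableSet (J i))
    (hJA : ∀ x ∈ openCube n, (∀ i < k, extendZero x i ∈ J i) → canonMap a b n x ∈ A) :
    ∏ i ∈ Finset.range k, ∫⁻ p in J i, canonWeight (potential V1 V2 i) n i p ≤
      P A * ∏ i ∈ Finset.range k, canonMass V1 V2 n i := by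
  obtain ⟨h0, htop, hlaw⟩ := law_apply hab hV1 hV2 hP
  have hA' : MeasurableSet (canonMap a b n ⁻¹' A) :=
    (contDiff_canonMap a b n).continuous.measurable hA
  rw [← Finset.prod_range_mul_prod_Ico _ hkn] at h0 htop hlaw
  have hR0 := right_ne_zero_of_mul h0
  have hRtop : ∏ i ∈ Finset.Ico k n, canonMass V1 V2 n i ≠ ⊤ := fun h => by
    rw [h, ENNReal.mul_top (left_ne_zero_of_mul h0)] at htop
    exact htop rfl
  have hmeas := fun i => measurable_canonWeight (continuousOn_potential hV1 hV2 i) n i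
  set f : ℕ → ℝ → ENNReal := fun i =>
    if i < k then (J i).indicator (canonWeight (potential V1 V2 i) n i)
    else canonWeight (potential V1 V2 i) n i
  have hf : ∀ i, Measurable (f i) := fun i => by
    by_cases h : i < k
    · simp only [f, h, if_true]; exact (hmeas i).indicator (hJ i)
    · simp only [f, h, if_false]; exact hmeas i
  have hint : ∫⁻ x : Fin n → ℝ, ∏ i : Fin n, f i (x i) =
      (∏ i ∈ Finset.range k, ∫⁻ p in J i, canonWeight (potential V1 V2 i) n i p) *
        ∏ i ∈ Finset.Ico k n, canonMass V1 V2 n i := by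
    rw [lintegral_fin_prod fun i => hf i,
      ← Finset.prod_range fun i => ∫⁻ t, f i t, ← Finset.prod_range_mul_prod_Ico _ hkn]
    congr 1
    · refine Finset.prod_congr rfl fun i hi => ?_
      simp only [f, Finset.mem_range.1 hi, if_true]
      rw [lintegral_indicator (hJ i)]
    · refine Finset.prod_congr rfl fun i hi => ?_
      simp only [f, not_lt.2 (Finset.mem_Ico.1 hi).1, if_false, canonMass]
  refine (ENNReal.mul_le_mul_iff_left hR0 hRtop).1 ?_
  rw [mul_assoc, hlaw A hA, ← hint, ← lintegral_indicator hA']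
  refine lintegral_mono fun x => ?_
  by_cases hx : x ∈ openCube n ∧ ∀ i < k, extendZero x i ∈ J i
  · rw [Set.indicator_of_mem (show x ∈ canonMap a b n ⁻¹' A from hJA x hx.1 hx.2)]
    refine Finset.prod_le_prod' fun i _ => ?_
    by_cases h : (i : ℕ) < k
    · simp only [f, h, if_true]; exact Set.indicator_le_self _ _ _
    · simp only [f, h, if_false]; exact le_rfl
  · suffices h : ∏ i : Fin n, f i (x i) = 0 by rw [h]; exact zero_le
    by_cases hc : x ∈ openCube n
    · push Not at hx
      obtain ⟨i, hik, hiJ⟩ := hx hc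
      refine Finset.prod_eq_zero (Finset.mem_univ (⟨i, hik.trans_le hkn⟩ : Fin n)) ?_
      simp only [f, hik, if_true]
      refine Set.indicator_of_notMem ?_ _
      simpa [extendZero, hik.trans_le hkn] using hiJ
    · simp only [openCube, Set.mem_univ_pi, not_forall] at hc
      obtain ⟨i, hi⟩ := hc
      refine Finset.prod_eq_zero (Finset.mem_univ i) ?_
      have : canonWeight (potential V1 V2 i) n i (x i) = 0 := Set.indicator_of_notMem hi _
      by_cases h : (i : ℕ) < k
      · simp only [f, h, if_true]
        exact Set.indicator_apply_eq_zero.2 fun _ => this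
      · simpa only [f, h, if_false] using this

end Law

/-- The exponential `exp (-W(p))` of the effective potential, extended by `0` to the endpoints of
`[0, 1]`. -/
def expWeight (V : ℝ → ℝ) (p : ℝ) : ℝ := Real.exp (-V p) * (p * (1 - p))

section Weight

variable {V : ℝ → ℝ} {p : ℝ}

lemma expWeight_pos (hp : p ∈ Set.Ioo (0 : ℝ) 1) : 0 < expWeight V p :=
  mul_pos (Real.exp_pos _) (mul_pos hp.1 (sub_pos.2 hp.2))

lemma exp_neg_effW (hp : p ∈ Set.Ioo (0 : ℝ) 1) : Real.exp (-effW V p) = expWeight V p := by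
  rw [effW, neg_sub, sub_eq_neg_add, Real.exp_add,
    Real.exp_log (mul_pos hp.1 (sub_pos.2 hp.2)), expWeight]

lemma mem_Ioo_of_expWeight_ne_zero (hp : p ∈ Set.Icc (0 : ℝ) 1) (h : expWeight V p ≠ 0) :
    p ∈ Set.Ioo (0 : ℝ) 1 := by
  rw [expWeight, mul_ne_zero_iff, mul_ne_zero_iff] at h
  exact ⟨lt_of_le_of_ne hp.1 h.2.1.symm, lt_of_le_of_ne hp.2 fun e => h.2.2 (by simp [e])⟩

lemma continuousOn_expWeight (hV : ContinuousOn V (Set.Icc 0 1)) :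
    ContinuousOn (expWeight V) (Set.Icc 0 1) := by
  unfold expWeight
  fun_prop

lemma ofReal_expWeight_pow_le (hp : p ∈ Set.Ioo (0 : ℝ) 1) (n i : ℕ) :
    ENNReal.ofReal (expWeight V p ^ n) ≤ canonWeight V n i p := by
  rw [canonWeight, Set.indicator_of_mem hp, expWeight, mul_pow, ← Real.exp_nat_mul, neg_mul,
    ← mul_neg]
  have h0 : 0 ≤ p * (1 - p) := mul_nonneg hp.1.le (sub_nonneg.2 hp.2.le)
  have h1 : p * (1 - p) ≤ 1 := mul_le_one₀ hp.2.le (sub_nonneg.2 hp.2.le) (by linarith [hp.1])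
  gcongr ENNReal.ofReal (_ * ?_)
  exact pow_le_pow_of_le_one h0 h1 (by omega)

lemma canonWeight_le {M : ℝ} (hM : ∀ p ∈ Set.Icc (0 : ℝ) 1, |V p| ≤ M) {i k n : ℕ} (hik : i < k)
    (hkn : k ≤ n) (hp : p ∈ Set.Ioo (0 : ℝ) 1) :
    canonWeight V n i p ≤ ENNReal.ofReal (Real.exp (k * M) * expWeight V p ^ (n - k)) := by
  have h0 : 0 ≤ p * (1 - p) := mul_nonneg hp.1.le (sub_nonneg.2 hp.2.le)
  have h1 : p * (1 - p) ≤ 1 := mul_le_one₀ hp.2.le (sub_nonneg.2 hp.2.le) (by linarith [hp.1])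
  rw [canonWeight, Set.indicator_of_mem hp, expWeight, mul_pow (Real.exp _),
    ← Real.exp_nat_mul, ← mul_assoc, ← Real.exp_add]
  have hV := (abs_le.1 (hM p (Set.Ioo_subset_Icc_self hp))).1
  have hk : (0 : ℝ) ≤ k := k.cast_nonneg
  refine ENNReal.ofReal_le_ofReal (mul_le_mul (Real.exp_le_exp.2 ?_)
    (pow_le_pow_of_le_one h0 h1 (by omega)) (pow_nonneg h0 _) (Real.exp_pos _).le)
  rw [Nat.cast_sub hkn]
  nlinarith

/-- A lower bound of Laplace type for the integral of `canonWeight` near a point. -/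
lemma exists_le_setLIntegral_canonWeight (hV : ContinuousOn V (Set.Icc 0 1))
    (hp : p ∈ Set.Ioo (0 : ℝ) 1) {r : ℝ} (hr : 0 ≤ r) (hrp : r < expWeight V p) {J : Set ℝ}
    (hJ : J ∈ 𝓝 p) : ∃ δ : ℝ, 0 < δ ∧ ∀ n i : ℕ,
      ENNReal.ofReal (δ * r ^ n) ≤ ∫⁻ q in J, canonWeight V n i q := by
  have hIoo : Set.Ioo (0 : ℝ) 1 ∈ 𝓝 p := isOpen_Ioo.mem_nhds hp
  have hg : {q | r < expWeight V q} ∈ 𝓝 p :=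
    ((continuousOn_expWeight hV).continuousAt
      (mem_of_superset hIoo Set.Ioo_subset_Icc_self)).eventually_const_lt hrp
  obtain ⟨ε, hε, hball⟩ := Metric.mem_nhds_iff.1 (inter_mem (inter_mem hJ hIoo) hg)
  refine ⟨2 * ε, by positivity, fun n i => ?_⟩
  calc ENNReal.ofReal (2 * ε * r ^ n)
      = ∫⁻ _ in Metric.ball p ε, ENNReal.ofReal (r ^ n) := by
        rw [setLIntegral_const, Real.volume_ball, mul_comm, ENNReal.ofReal_mul (pow_nonneg hr n)]
    _ ≤ ∫⁻ q in Metric.ball p ε, canonWeight V n i q := by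
        refine setLIntegral_mono' Metric.isOpen_ball.measurableSet fun q hq => ?_
        exact (ENNReal.ofReal_le_ofReal (pow_le_pow_left₀ hr (hball hq).2.le n)).trans
          (ofReal_expWeight_pow_le (hball hq).1.2 n i)
    _ ≤ ∫⁻ q in J, canonWeight V n i q :=
        lintegral_mono_set fun q hq => (hball hq).1.1

lemma lintegral_canonWeight_le {M : ℝ} (hM : ∀ p ∈ Set.Icc (0 : ℝ) 1, |V p| ≤ M) {i k n : ℕ}
    (hik : i < k) (hkn : k ≤ n) {g : ℝ} (hg : ∀ q ∈ Set.Ioo (0 : ℝ) 1, expWeight V q ≤ g) :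
    ∫⁻ q, canonWeight V n i q ≤ ENNReal.ofReal (Real.exp (k * M) * g ^ (n - k)) := by
  calc ∫⁻ q, canonWeight V n i q
      = ∫⁻ q in Set.Ioo (0 : ℝ) 1, canonWeight V n i q := by
        rw [← lintegral_indicator measurableSet_Ioo, canonWeight, Set.indicator_indicator,
          Set.inter_self]
    _ ≤ ∫⁻ _ in Set.Ioo (0 : ℝ) 1, ENNReal.ofReal (Real.exp (k * M) * g ^ (n - k)) := by
        refine setLIntegral_mono' measurableSet_Ioo fun q hq => ?_
        refine (canonWeight_le hM hik hkn hq).trans (ENNReal.ofReal_le_ofReal ?_)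
        have := (expWeight_pos (V := V) hq).le
        gcongr
        exact hg q hq
    _ = ENNReal.ofReal (Real.exp (k * M) * g ^ (n - k)) := by
        rw [setLIntegral_const, Real.volume_Ioo]
        simp

end Weight

section Products

variable {V : ℕ → ℝ → ℝ}

lemma exists_le_prod_setLIntegral (hV : ∀ i, ContinuousOn (V i) (Set.Icc 0 1)) {k : ℕ}
    (hk : k ≠ 0) {p : ℕ → ℝ} (hp : ∀ i < k, p i ∈ Set.Ioo (0 : ℝ) 1) {J : ℕ → Set ℝ}
    (hJ : ∀ i < k, J i ∈ 𝓝 (p i)) {s : ℝ} (hs : 0 < s)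
    (hsp : s < ∏ i ∈ Finset.range k, expWeight (V i) (p i)) : ∃ δ : ℝ, 0 < δ ∧ ∀ n : ℕ,
      ENNReal.ofReal (δ * s ^ n) ≤
        ∏ i ∈ Finset.range k, ∫⁻ q in J i, canonWeight (V i) n i q := by
  set Γ := ∏ i ∈ Finset.range k, expWeight (V i) (p i)
  have hΓ : 0 < Γ := hs.trans hsp
  set ρ : ℝ := (s / Γ) ^ ((k : ℝ)⁻¹)
  have hρk : ρ ^ k = s / Γ := Real.rpow_inv_natCast_pow (by positivity) hk
  have hρ0 : 0 ≤ ρ := by positivity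
  have hρ1 : ρ < 1 := Real.rpow_lt_one (by positivity) ((div_lt_one hΓ).2 hsp)
    (inv_pos.2 (Nat.cast_pos.2 (Nat.pos_of_ne_zero hk)))
  have hδ : ∀ i, ∃ δ : ℝ, 0 < δ ∧ (i < k → ∀ n : ℕ, ENNReal.ofReal
      (δ * (ρ * expWeight (V i) (p i)) ^ n) ≤ ∫⁻ q in J i, canonWeight (V i) n i q) := by
    intro i
    by_cases hi : i < k
    · have hpos := expWeight_pos (V := V i) (hp i hi)
      obtain ⟨δ, h0, h⟩ := exists_le_setLIntegral_canonWeight (hV i) (hp i hi)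
        (mul_nonneg hρ0 hpos.le) (mul_lt_of_lt_one_left hpos hρ1) (hJ i hi)
      exact ⟨δ, h0, fun _ n => h n i⟩
    · exact ⟨1, one_pos, fun h => absurd h hi⟩
  choose δ hδ0 hδ using hδ
  refine ⟨∏ i ∈ Finset.range k, δ i, Finset.prod_pos fun i _ => hδ0 i, fun n => ?_⟩
  have hprod : (∏ i ∈ Finset.range k, δ i) * s ^ n =
      ∏ i ∈ Finset.range k, δ i * (ρ * expWeight (V i) (p i)) ^ n := by
    rw [Finset.prod_mul_distrib, Finset.prod_pow, Finset.prod_mul_distrib, Finset.prod_const,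
      Finset.card_range, hρk, div_mul_cancel₀ _ hΓ.ne']
  rw [hprod, ENNReal.ofReal_prod_of_nonneg fun i hi => mul_nonneg (hδ0 i).le (pow_nonneg
    (mul_nonneg hρ0 (expWeight_pos (hp i (Finset.mem_range.1 hi))).le) n)]
  exact Finset.prod_le_prod' fun i hi => hδ i (Finset.mem_range.1 hi) n

lemma prod_canonWeight_le {M : ℝ} (hM : ∀ i, ∀ p ∈ Set.Icc (0 : ℝ) 1, |V i p| ≤ M) {k n : ℕ}
    (hkn : k ≤ n) {p : ℕ → ℝ} (hp : ∀ i < k, p i ∈ Set.Ioo (0 : ℝ) 1) :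
    ∏ i ∈ Finset.range k, canonWeight (V i) n i (p i) ≤ ENNReal.ofReal
      (Real.exp (k * M) ^ k * (∏ i ∈ Finset.range k, expWeight (V i) (p i)) ^ (n - k)) := by
  have hprod : Real.exp (k * M) ^ k * (∏ i ∈ Finset.range k, expWeight (V i) (p i)) ^ (n - k) =
      ∏ i ∈ Finset.range k, Real.exp (k * M) * expWeight (V i) (p i) ^ (n - k) := by
    rw [Finset.prod_mul_distrib, Finset.prod_pow, Finset.prod_const, Finset.card_range]
  rw [hprod, ENNReal.ofReal_prod_of_nonneg fun i hi => mul_nonneg (Real.exp_pos _).le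
    (pow_nonneg (expWeight_pos (hp i (Finset.mem_range.1 hi))).le _)]
  exact Finset.prod_le_prod' fun i hi =>
    canonWeight_le (hM i) (Finset.mem_range.1 hi) hkn (hp i (Finset.mem_range.1 hi))

lemma prod_lintegral_canonWeight_le {M : ℝ} (hM : ∀ i, ∀ p ∈ Set.Icc (0 : ℝ) 1, |V i p| ≤ M)
    {k n : ℕ} (hkn : k ≤ n) {p : ℕ → ℝ} (hp : ∀ i < k, p i ∈ Set.Ioo (0 : ℝ) 1)
    (hmax : ∀ i < k, ∀ q ∈ Set.Ioo (0 : ℝ) 1, expWeight (V i) q ≤ expWeight (V i) (p i)) :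
    ∏ i ∈ Finset.range k, ∫⁻ q, canonWeight (V i) n i q ≤ ENNReal.ofReal
      (Real.exp (k * M) ^ k * (∏ i ∈ Finset.range k, expWeight (V i) (p i)) ^ (n - k)) := by
  have hprod : Real.exp (k * M) ^ k * (∏ i ∈ Finset.range k, expWeight (V i) (p i)) ^ (n - k) =
      ∏ i ∈ Finset.range k, Real.exp (k * M) * expWeight (V i) (p i) ^ (n - k) := by
    rw [Finset.prod_mul_distrib, Finset.prod_pow, Finset.prod_const, Finset.card_range]
  rw [hprod, ENNReal.ofReal_prod_of_nonneg fun i hi => mul_nonneg (Real.exp_pos _).le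
    (pow_nonneg (expWeight_pos (hp i (Finset.mem_range.1 hi))).le _)]
  exact Finset.prod_le_prod' fun i hi =>
    lintegral_canonWeight_le (hM i) (Finset.mem_range.1 hi) hkn (hmax i (Finset.mem_range.1 hi))

lemma exists_bound_potential {V1 V2 : ℝ → ℝ} (hV1 : ContinuousOn V1 (Set.Icc 0 1))
    (hV2 : ContinuousOn V2 (Set.Icc 0 1)) :
    ∃ M : ℝ, ∀ i, ∀ p ∈ Set.Icc (0 : ℝ) 1, |potential V1 V2 i p| ≤ M := by
  obtain ⟨M1, h1⟩ := isCompact_Icc.exists_bound_of_continuousOn hV1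
  obtain ⟨M2, h2⟩ := isCompact_Icc.exists_bound_of_continuousOn hV2
  refine ⟨max M1 M2, fun i p hp => ?_⟩
  rw [potential]
  split_ifs
  · exact (h1 p hp).trans (le_max_left _ _)
  · exact (h2 p hp).trans (le_max_right _ _)

end Products

section LogLimits

lemma tendsto_log_geometric {C r : ℝ} (hC : 0 < C) (hr : 0 < r) :
    Tendsto (fun n : ℕ => (((n : ℝ)⁻¹ : ℝ) : EReal) * ENNReal.log (ENNReal.ofReal (C * r ^ n)))
      atTop (𝓝 ((Real.log r : ℝ) : EReal)) := by
  have hreal : Tendsto (fun n : ℕ => (n : ℝ)⁻¹ * Real.log C + Real.log r) atTop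
      (𝓝 (Real.log r)) := by
    simpa using (tendsto_inv_atTop_nhds_zero_nat (𝕜 := ℝ)).mul_const (Real.log C) |>.add_const
      (Real.log r)
  refine ((continuous_coe_real_ereal.tendsto _).comp hreal).congr' ?_
  filter_upwards [eventually_ge_atTop 1] with n hn
  have hn' : (n : ℝ) ≠ 0 := by positivity
  rw [ENNReal.log_ofReal_of_pos (by positivity), ← EReal.coe_mul, Real.log_mul hC.ne'
    (pow_pos hr n).ne', Real.log_pow, Function.comp_apply, mul_add, inv_mul_cancel_left₀ hn']

lemma limsup_log_le {u : ℕ → ENNReal} {C β : ℝ} (hC : 0 < C)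
    (hu : ∀ᶠ n in atTop, u n ≤ ENNReal.ofReal (C * Real.exp β ^ n)) :
    limsup (fun n : ℕ => (((n : ℝ)⁻¹ : ℝ) : EReal) * ENNReal.log (u n)) atTop ≤ β := by
  have := (tendsto_log_geometric hC (Real.exp_pos β)).limsup_eq
  rw [Real.log_exp] at this
  rw [← this]
  refine limsup_le_limsup (hu.mono fun n hn => ?_)
  exact mul_le_mul_of_nonneg_left (ENNReal.log_monotone hn) (EReal.coe_nonneg.2 (by positivity))

lemma le_liminf_log {u : ℕ → ENNReal} {C β : ℝ} (hC : 0 < C)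
    (hu : ∀ᶠ n in atTop, ENNReal.ofReal (C * Real.exp β ^ n) ≤ u n) :
    (β : EReal) ≤ liminf (fun n : ℕ => (((n : ℝ)⁻¹ : ℝ) : EReal) * ENNReal.log (u n)) atTop := by
  have := (tendsto_log_geometric hC (Real.exp_pos β)).liminf_eq
  rw [Real.log_exp] at this
  rw [← this]
  refine liminf_le_liminf (hu.mono fun n hn => ?_)
  exact mul_le_mul_of_nonneg_left (ENNReal.log_monotone hn) (EReal.coe_nonneg.2 (by positivity))

end LogLimits

/-- The location of the minimum of the effective potential of the `(i + 1)`-st canonical moment. -/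
def optimum (p1s p2s : ℝ) (i : ℕ) : ℝ := if i % 2 = 0 then p1s else p2s

/-- The product of the weights `expWeight` of the first `k` canonical moments. -/
def prodWeight (V1 V2 : ℝ → ℝ) (k : ℕ) (x : ℕ → ℝ) : ℝ :=
  ∏ i ∈ Finset.range k, expWeight (potential V1 V2 i) (x i)

lemma extendZero_restrict {k n : ℕ} (x : Fin n → ℝ) {i : ℕ} (hi : i < k) :
    extendZero (fun j : Fin k => extendZero x j) i = extendZero x i := by
  rw [extendZero, dif_pos hi]

/-- Forgetting higher moments corresponds to forgetting higher canonical moments. -/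
lemma extendZero_canonMap (a b : ℝ) {k n : ℕ} (hkn : k ≤ n) (x : Fin n → ℝ) :
    (fun j : Fin k => extendZero (canonMap a b n x) j) =
      canonMap a b k fun j : Fin k => extendZero x j := by
  funext j
  rw [extendZero, dif_pos (j.2.trans_le hkn), canonMap, canonMap]
  exact canonMoment_congr (j := k) (fun i hi => (extendZero_restrict x hi).symm)
    (Nat.succ_le_of_lt j.2)

lemma restrict_mem_openCube {k n : ℕ} (hkn : k ≤ n) {x : Fin n → ℝ} (hx : x ∈ openCube n) :
    (fun j : Fin k => extendZero x j) ∈ openCube k :=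
  fun j _ => extendZero_mem hx (j.2.trans_le hkn)

lemma prodWeight_congr (V1 V2 : ℝ → ℝ) {k : ℕ} {x y : ℕ → ℝ} (h : ∀ i < k, x i = y i) :
    prodWeight V1 V2 k x = prodWeight V1 V2 k y :=
  Finset.prod_congr rfl fun i hi => by rw [h i (Finset.mem_range.1 hi)]

lemma prodWeight_pos (V1 V2 : ℝ → ℝ) {k : ℕ} {x : ℕ → ℝ}
    (hx : ∀ i < k, x i ∈ Set.Ioo (0 : ℝ) 1) : 0 < prodWeight V1 V2 k x :=
  Finset.prod_pos fun i hi => expWeight_pos (hx i (Finset.mem_range.1 hi))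

lemma measurable_extendZero (k n : ℕ) :
    Measurable fun (v : Fin n → ℝ) (j : Fin k) => extendZero v j := by
  refine measurable_pi_lambda _ fun j => ?_
  unfold extendZero
  split_ifs
  · exact measurable_pi_apply _
  · exact measurable_const

section Rate

variable {a b : ℝ} {V1 V2 : ℝ → ℝ} {p1s p2s : ℝ}

lemma optimum_mem (hp1 : p1s ∈ Set.Ioo (0 : ℝ) 1) (hp2 : p2s ∈ Set.Ioo (0 : ℝ) 1) (i : ℕ) :
    optimum p1s p2s i ∈ Set.Ioo (0 : ℝ) 1 := by
  rw [optimum]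
  split_ifs <;> assumption

/-- The rate function in terms of canonical moments. -/
lemma rateC_canonMap (hab : a < b) (V1 V2 : ℝ → ℝ) (hp1 : p1s ∈ Set.Ioo (0 : ℝ) 1)
    (hp2 : p2s ∈ Set.Ioo (0 : ℝ) 1) {k : ℕ} {x : Fin k → ℝ} (hx : x ∈ openCube k) :
    ∃ α : ℝ, rateC a b V1 V2 p1s p2s k (canonMap a b k x) = α ∧
      prodWeight V1 V2 k (extendZero x) =
        prodWeight V1 V2 k (optimum p1s p2s) * Real.exp (-α) := by
  refine ⟨_, if_pos ?_, ?_⟩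
  · rw [interior_momentSpace hab]
    exact Set.mem_image_of_mem _ hx
  · rw [prodWeight, prodWeight, ← Finset.sum_neg_distrib, Real.exp_sum, Finset.prod_range,
      Finset.prod_range, ← Finset.prod_mul_distrib]
    refine Finset.prod_congr rfl fun j _ => ?_
    rw [canCompact_canonMap hab hx, extendZero_val,
      ← exp_neg_effW (hx j (Set.mem_univ _)), ← exp_neg_effW (optimum_mem hp1 hp2 j),
      ← Real.exp_add, potential, optimum]
    congr 1
    split_ifs <;> ring

lemma rateC_eq_top (hab : a < b) {k : ℕ} {m : Fin k → ℝ} (hm : m ∉ canonMap a b k '' openCube k) :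
    rateC a b V1 V2 p1s p2s k m = ⊤ := by
  rw [← interior_momentSpace hab] at hm
  exact if_neg hm

/-- The sublevel sets of the rate function are compact. -/
lemma isCompact_rateC_le (hab : a < b) (hV1 : ContinuousOn V1 (Set.Icc 0 1))
    (hV2 : ContinuousOn V2 (Set.Icc 0 1)) (hp1 : p1s ∈ Set.Ioo (0 : ℝ) 1)
    (hp2 : p2s ∈ Set.Ioo (0 : ℝ) 1) (k : ℕ) (c : ℝ) :
    IsCompact {m : Fin k → ℝ | rateC a b V1 V2 p1s p2s k m ≤ (c : EReal)} := by
  set G := prodWeight V1 V2 k (optimum p1s p2s)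
  have hG : 0 < G := prodWeight_pos V1 V2 fun i _ => optimum_mem hp1 hp2 i
  set K : Set (Fin k → ℝ) := Set.univ.pi fun _ => Set.Icc 0 1
  have hK : IsCompact K := isCompact_univ_pi fun _ => isCompact_Icc
  have hcont : ContinuousOn (fun x : Fin k → ℝ => prodWeight V1 V2 k (extendZero x)) K := by
    simp only [prodWeight, Finset.prod_range, extendZero_val]
    refine continuousOn_finsetProd _ fun i _ => ?_
    exact (continuousOn_expWeight (continuousOn_potential hV1 hV2 i)).comp
      (continuous_apply i).continuousOn fun x hx => hx i (Set.mem_univ i)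
  have hS : IsCompact (K ∩ (fun x => prodWeight V1 V2 k (extendZero x)) ⁻¹'
      Set.Ici (G * Real.exp (-c))) :=
    hK.of_isClosed_subset (hcont.preimage_isClosed_of_isClosed hK.isClosed isClosed_Ici)
      Set.inter_subset_left
  have key : ∀ x ∈ openCube k, (rateC a b V1 V2 p1s p2s k (canonMap a b k x) ≤ (c : EReal) ↔
      G * Real.exp (-c) ≤ prodWeight V1 V2 k (extendZero x)) := by
    intro x hx
    obtain ⟨α, h1, h2⟩ := rateC_canonMap (V1 := V1) (V2 := V2) hab hp1 hp2 hx
    rw [h1, h2, EReal.coe_le_coe_iff, mul_le_mul_iff_right₀ hG, Real.exp_le_exp, neg_le_neg_iff]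
  suffices h : {m : Fin k → ℝ | rateC a b V1 V2 p1s p2s k m ≤ (c : EReal)} = _ by
    rw [h]
    exact hS.image (contDiff_canonMap a b k).continuous
  ext m
  constructor
  · intro hm
    by_cases h : m ∈ canonMap a b k '' openCube k
    · obtain ⟨x, hx, rfl⟩ := h
      exact ⟨x, ⟨fun i hi => Set.Ioo_subset_Icc_self (hx i hi), (key x hx).1 hm⟩, rfl⟩
    · rw [Set.mem_ofPred_eq, rateC_eq_top hab h] at hm
      exact absurd hm (not_le.2 (EReal.coe_lt_top c))
  · rintro ⟨x, ⟨hxK, hx⟩, rfl⟩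
    refine (key x fun i hi => ?_).2 hx
    have hpos : 0 < prodWeight V1 V2 k (extendZero x) :=
      (mul_pos hG (Real.exp_pos _)).trans_le hx
    have := Finset.prod_ne_zero_iff.1 hpos.ne' i (Finset.mem_range.2 i.2)
    rw [extendZero_val] at this
    exact mem_Ioo_of_expWeight_ne_zero (hxK i hi) this

lemma lowerSemicontinuous_rateC (hab : a < b) (hV1 : ContinuousOn V1 (Set.Icc 0 1))
    (hV2 : ContinuousOn V2 (Set.Icc 0 1)) (hp1 : p1s ∈ Set.Ioo (0 : ℝ) 1)
    (hp2 : p2s ∈ Set.Ioo (0 : ℝ) 1) (k : ℕ) :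
    LowerSemicontinuous (rateC a b V1 V2 p1s p2s k) := by
  rw [lowerSemicontinuous_iff_isClosed_preimage]
  intro y
  induction y with
  | bot =>
    convert isClosed_empty
    refine Set.eq_empty_iff_forall_notMem.2 fun m hm => ?_
    rw [Set.mem_preimage, Set.mem_Iic, le_bot_iff, rateC] at hm
    split_ifs at hm
    · exact EReal.coe_ne_bot _ hm
    · exact top_ne_bot hm
  | coe c => exact (isCompact_rateC_le hab hV1 hV2 hp1 hp2 k c).isClosed
  | top => simp

end Rate

section LDP

variable {a b : ℝ} {V1 V2 : ℝ → ℝ} {p1s p2s : ℝ}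

lemma ofReal_le_of_mul_le {x y : ENNReal} {c d : ℝ} (hd : 0 < d) (hxy : x * y ≤ ENNReal.ofReal c)
    (hy : ENNReal.ofReal d ≤ y) : x ≤ ENNReal.ofReal (c / d) := by
  rw [ENNReal.ofReal_div_of_pos hd, ENNReal.le_div_iff_mul_le (by simp [hd]) (by simp)]
  exact (mul_le_mul_right hy x).trans hxy

lemma ofReal_le_of_le_mul {x y : ENNReal} {c d : ℝ} (hd : 0 < d) (hxy : ENNReal.ofReal c ≤ x * y)
    (hy : y ≤ ENNReal.ofReal d) : ENNReal.ofReal (c / d) ≤ x := by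
  rw [ENNReal.ofReal_div_of_pos hd]
  exact ENNReal.div_le_of_le_mul (hxy.trans (mul_le_mul_right hy x))

lemma limsup_log_law_le (hab : a < b) (hV1 : ContinuousOn V1 (Set.Icc 0 1))
    (hV2 : ContinuousOn V2 (Set.Icc 0 1)) (hp1 : p1s ∈ Set.Ioo (0 : ℝ) 1)
    (hp2 : p2s ∈ Set.Ioo (0 : ℝ) 1) {k : ℕ} (hk : 1 ≤ k) {Q : (n : ℕ) → Measure (Fin n → ℝ)}
    (hQ : ∀ n, 1 ≤ n → isCompactDist a b V1 V2 n (Q n)) {U : Set (Fin k → ℝ)}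
    (hU : MeasurableSet U) :
    limsup (fun n : ℕ => (((n : ℝ)⁻¹ : ℝ) : EReal) *
      ENNReal.log (Q n {v | (fun j : Fin k => extendZero v j) ∈ U})) atTop ≤
        -sInf (rateC a b V1 V2 p1s p2s k '' U) := by
  refine EReal.le_of_forall_lt_iff_le.1 fun β hβ => ?_
  obtain ⟨α, hβα, hα⟩ := EReal.lt_iff_exists_real_btwn.1 (EReal.neg_lt_comm.1 hβ)
  rw [← EReal.coe_neg, EReal.coe_lt_coe_iff] at hβα
  set G := prodWeight V1 V2 k (optimum p1s p2s)
  have hG : 0 < G := prodWeight_pos V1 V2 fun i _ => optimum_mem hp1 hp2 i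
  set γ := G * Real.exp (-α)
  set s := G * Real.exp (-(β + α))
  have hγ : 0 < γ := mul_pos hG (Real.exp_pos _)
  have hs : 0 < s := mul_pos hG (Real.exp_pos _)
  have hsG : s < G := mul_lt_of_lt_one_right hG (Real.exp_lt_one_iff.2 (by linarith))
  obtain ⟨δ, hδ, hmass⟩ := exists_le_prod_setLIntegral (continuousOn_potential hV1 hV2)
    (Nat.one_le_iff_ne_zero.1 hk) (fun i _ => optimum_mem hp1 hp2 i)
    (J := fun _ => Set.univ) (fun _ _ => univ_mem) hs hsG
  obtain ⟨M, hM⟩ := exists_bound_potential hV1 hV2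
  refine limsup_log_le (C := Real.exp (k * M) ^ k / (δ * γ ^ k)) (by positivity) ?_
  filter_upwards [eventually_ge_atTop k] with n hn
  have hle : Q n {v | (fun j : Fin k => extendZero v j) ∈ U} *
      ∏ i ∈ Finset.range k, canonMass V1 V2 n i ≤
        ENNReal.ofReal (Real.exp (k * M) ^ k * γ ^ (n - k)) := by
    refine law_mul_le hab hV1 hV2 hn (hQ n (hk.trans hn)) (measurable_extendZero k n hU)
      fun x hx hxU => ?_
    refine (prod_canonWeight_le hM hn fun i hi => extendZero_mem hx (hi.trans_le hn)).trans ?_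
    have hx' := restrict_mem_openCube hn hx
    obtain ⟨α', h1, h2⟩ := rateC_canonMap (V1 := V1) (V2 := V2) hab hp1 hp2 hx'
    rw [prodWeight_congr V1 V2 fun i hi => extendZero_restrict x hi] at h2
    rw [Set.mem_preimage, extendZero_canonMap a b hn] at hxU
    have hαα' : α < α' := by
      rw [← EReal.coe_lt_coe_iff, ← h1]
      exact hα.trans_le (sInf_le (Set.mem_image_of_mem _ hxU))
    change ENNReal.ofReal (_ * prodWeight V1 V2 k (extendZero x) ^ _) ≤ _
    have hle : G * Real.exp (-α') ≤ γ :=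
      mul_le_mul_of_nonneg_left (Real.exp_le_exp.2 (by linarith)) hG.le
    rw [h2]
    gcongr
  have hmass' : ENNReal.ofReal (δ * s ^ n) ≤ ∏ i ∈ Finset.range k, canonMass V1 V2 n i := by
    simpa only [Measure.restrict_univ, canonMass] using hmass n
  refine (ofReal_le_of_mul_le (by positivity) hle hmass').trans_eq (congrArg _ ?_)
  have hexp : Real.exp β = γ / s := by
    rw [mul_div_mul_left _ _ hG.ne', ← Real.exp_sub]
    congr 1
    ring
  rw [hexp, pow_sub₀ γ hγ.ne' hn, div_pow]
  field_simp

lemma le_liminf_log_law (hab : a < b) (hV1 : ContinuousOn V1 (Set.Icc 0 1))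
    (hV2 : ContinuousOn V2 (Set.Icc 0 1)) (hp1 : p1s ∈ Set.Ioo (0 : ℝ) 1)
    (hp2 : p2s ∈ Set.Ioo (0 : ℝ) 1)
    (hmin1 : ∀ p ∈ Set.Ioo (0 : ℝ) 1, effW V1 p1s ≤ effW V1 p)
    (hmin2 : ∀ p ∈ Set.Ioo (0 : ℝ) 1, effW V2 p2s ≤ effW V2 p)
    {k : ℕ} (hk : 1 ≤ k) {Q : (n : ℕ) → Measure (Fin n → ℝ)}
    (hQ : ∀ n, 1 ≤ n → isCompactDist a b V1 V2 n (Q n)) {O : Set (Fin k → ℝ)} (hO : IsOpen O) :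
    -sInf (rateC a b V1 V2 p1s p2s k '' O) ≤
      liminf (fun n : ℕ => (((n : ℝ)⁻¹ : ℝ) : EReal) *
        ENNReal.log (Q n {v | (fun j : Fin k => extendZero v j) ∈ O})) atTop := by
  refine EReal.ge_of_forall_gt_iff_ge.1 fun β hβ => ?_
  obtain ⟨_, ⟨m, hmO, rfl⟩, hm⟩ := sInf_lt_iff.1 (EReal.lt_neg_comm.1 hβ)
  by_cases hcube : m ∈ canonMap a b k '' openCube k
  swap
  · rw [rateC_eq_top hab hcube] at hm
    exact absurd hm not_top_lt
  obtain ⟨x, hx, rfl⟩ := hcube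
  obtain ⟨α, h1, h2⟩ := rateC_canonMap (V1 := V1) (V2 := V2) hab hp1 hp2 hx
  rw [h1, ← EReal.coe_neg, EReal.coe_lt_coe_iff] at hm
  set G := prodWeight V1 V2 k (optimum p1s p2s)
  have hG : 0 < G := prodWeight_pos V1 V2 fun i _ => optimum_mem hp1 hp2 i
  set s := G * Real.exp β
  have hs : 0 < s := mul_pos hG (Real.exp_pos _)
  have hsx : s < prodWeight V1 V2 k (extendZero x) := by
    rw [h2]
    exact mul_lt_mul_of_pos_left (Real.exp_lt_exp.2 (by linarith)) hG
  obtain ⟨ε, hε, hball⟩ := Metric.mem_nhds_iff.1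
    ((hO.preimage (contDiff_canonMap a b k).continuous).mem_nhds hmO)
  obtain ⟨δ, hδ, hbox⟩ := exists_le_prod_setLIntegral (continuousOn_potential hV1 hV2)
    (Nat.one_le_iff_ne_zero.1 hk) (fun i hi => extendZero_mem hx hi)
    (J := fun i => Metric.ball (extendZero x i) ε) (fun _ _ => Metric.ball_mem_nhds _ hε) hs hsx
  obtain ⟨M, hM⟩ := exists_bound_potential hV1 hV2
  refine le_liminf_log (C := δ * G ^ k / Real.exp (k * M) ^ k) (by positivity) ?_
  filter_upwards [eventually_ge_atTop k] with n hn
  have hle := (hbox n).trans <| le_law_mul hab hV1 hV2 hn (hQ n (hk.trans hn))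
    (measurable_extendZero k n hO.measurableSet) (fun _ => Metric.isOpen_ball.measurableSet)
    fun y hy hyJ => by
      rw [Set.mem_preimage, extendZero_canonMap a b hn]
      refine hball ((dist_pi_lt_iff hε).2 fun j => ?_)
      simpa using hyJ j j.2
  have hmax : ∀ i < k, ∀ q ∈ Set.Ioo (0 : ℝ) 1, expWeight (potential V1 V2 i) q ≤
      expWeight (potential V1 V2 i) (optimum p1s p2s i) := by
    intro i _ q hq
    rw [← exp_neg_effW hq, ← exp_neg_effW (optimum_mem hp1 hp2 i), Real.exp_le_exp, neg_le_neg_iff,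
      potential, optimum]
    split_ifs
    exacts [hmin1 q hq, hmin2 q hq]
  have hmass : ∏ i ∈ Finset.range k, canonMass V1 V2 n i ≤
      ENNReal.ofReal (Real.exp (k * M) ^ k * G ^ (n - k)) :=
    prod_lintegral_canonWeight_le hM hn (fun i _ => optimum_mem hp1 hp2 i) hmax
  refine le_of_eq_of_le (congrArg _ ?_) (ofReal_le_of_le_mul (by positivity) hle hmass)
  rw [pow_sub₀ G hG.ne' hn, mul_pow]
  field_simp

end LDP

end CanonicalMoments

/-- Large deviations principle for the first `k` coordinates under
`ℙ_{n,[a,b],V₁,V₂}`, with speed `n` and good rate function `rateC`. -/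
theorem statement16 (a b : ℝ) (hab : a < b) (V1 V2 : ℝ → ℝ)
    (hV1c : ContinuousOn V1 (Set.Icc 0 1)) (hV1d : ContDiffOn ℝ 2 V1 (Set.Ioo 0 1))
    (hV2c : ContinuousOn V2 (Set.Icc 0 1)) (hV2d : ContDiffOn ℝ 2 V2 (Set.Ioo 0 1))
    (p1s p2s : ℝ) (hp1 : p1s ∈ Set.Ioo (0 : ℝ) 1) (hp2 : p2s ∈ Set.Ioo (0 : ℝ) 1)
    (hmin1 : ∀ p ∈ Set.Ioo (0 : ℝ) 1, p ≠ p1s → effW V1 p1s < effW V1 p)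
    (hmin2 : ∀ p ∈ Set.Ioo (0 : ℝ) 1, p ≠ p2s → effW V2 p2s < effW V2 p)
    (Ω : Type) [MeasurableSpace Ω] (P : Measure Ω) [IsProbabilityMeasure P]
    (X : (n : ℕ) → Ω → (Fin n → ℝ)) (hX : ∀ n, Measurable (X n))
    (hlaw : ∀ n : ℕ, 1 ≤ n → isCompactDist a b V1 V2 n (P.map (X n)))
    (k : ℕ) (hk : 1 ≤ k) :
    LowerSemicontinuous (rateC a b V1 V2 p1s p2s k) ∧
    (∀ c : ℝ, IsCompact {m : Fin k → ℝ | rateC a b V1 V2 p1s p2s k m ≤ (c : EReal)}) ∧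
    (∀ O : Set (Fin k → ℝ), IsOpen O →
      - sInf (rateC a b V1 V2 p1s p2s k '' O) ≤
        Filter.liminf (fun n : ℕ => (((n : ℝ)⁻¹ : ℝ) : EReal) *
          ENNReal.log (P {ω | (fun j : Fin k =>
            if h : (j : ℕ) < n then X n ω ⟨(j : ℕ), h⟩ else 0) ∈ O})) atTop) ∧
    (∀ U : Set (Fin k → ℝ), IsClosed U →
      Filter.limsup (fun n : ℕ => (((n : ℝ)⁻¹ : ℝ) : EReal) *
          ENNReal.log (P {ω | (fun j : Fin k =>
            if h : (j : ℕ) < n then X n ω ⟨(j : ℕ), h⟩ else 0) ∈ U})) atTop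
        ≤ - sInf (rateC a b V1 V2 p1s p2s k '' U)) := by
  have hcoord : ∀ S : Set (Fin k → ℝ), MeasurableSet S → ∀ n,
      P {ω | (fun j : Fin k => if h : (j : ℕ) < n then X n ω ⟨(j : ℕ), h⟩ else 0) ∈ S} =
        P.map (X n) {v | (fun j : Fin k => CanonicalMoments.extendZero v j) ∈ S} :=
    fun S hS n =>
      (Measure.map_apply (hX n) (CanonicalMoments.measurable_extendZero k n hS)).symm
  have hle : ∀ {V : ℝ → ℝ} {q : ℝ}, (∀ p ∈ Set.Ioo (0 : ℝ) 1, p ≠ q → effW V q < effW V p) →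
      ∀ p ∈ Set.Ioo (0 : ℝ) 1, effW V q ≤ effW V p := by
    intro V q h p hp
    by_cases hpq : p = q
    · rw [hpq]
    · exact (h p hp hpq).le
  refine ⟨CanonicalMoments.lowerSemicontinuous_rateC hab hV1c hV2c hp1 hp2 k,
    CanonicalMoments.isCompact_rateC_le hab hV1c hV2c hp1 hp2 k, fun O hO => ?_, fun U hU => ?_⟩
  · simp only [hcoord O hO.measurableSet]
    exact CanonicalMoments.le_liminf_log_law hab hV1c hV2c hp1 hp2 (hle hmin1) (hle hmin2) hk hlaw
      hO
  · simp only [hcoord U hU.measurableSet]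
    exact CanonicalMoments.limsup_log_law_le hab hV1c hV2c hp1 hp2 hk hlaw hU.measurableSet

end
end

section
/- Let V ∈ C²((0,∞)) be continuous at 0 and satisfy, for some ε > 0 and all sufficiently large z, V(z)/log z ≥ 2+ε. Assume W(z) = V(z) − log z has a unique minimizer z* ∈ (0,∞) with W''(z*) > 0. Fix an integer r ≥ 1, and for each n > r let X_n be a real random variable with probability density f_n(x) = c_n^{-1} e^{−nV(x)} x^{n−r} on (0,∞) (and 0 elsewhere), where c_n = ∫_0^∞ e^{−nV(x)} x^{n−r} dx < ∞. Then √n (X_n − z*) converges in distribution, as n→∞, to the centered normal distribution with variance 1/W''(z*). -/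
open MeasureTheory Real Filter Topology Polynomial

noncomputable section

/-- Second-order Taylor quotient at a critical point. -/
lemma tendsto_sub_div_sq_of_deriv_eq_zero {W : ℝ → ℝ} {a : ℝ}
    (hd : ∀ᶠ x in 𝓝 a, DifferentiableAt ℝ W x) (h0 : deriv W a = 0)
    (h2 : DifferentiableAt ℝ (deriv W) a) :
    Tendsto (fun x => (W x - W a) / (x - a) ^ 2) (𝓝[≠] a) (𝓝 (deriv (deriv W) a / 2)) := by
  refine HasDerivAt.lhopital_zero_nhdsNE (f' := deriv W) (g' := fun x => 2 * (x - a)) ?_ ?_ ?_ ?_ ?_ ?_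
  · filter_upwards [hd.filter_mono nhdsWithin_le_nhds] with x hx
    exact hx.hasDerivAt.sub_const _
  · refine Eventually.of_forall fun x => ?_
    simpa using ((hasDerivAt_id x).sub_const a).fun_pow 2
  · filter_upwards [self_mem_nhdsWithin] with x hx
    exact mul_ne_zero two_ne_zero (sub_ne_zero.mpr hx)
  · have : Tendsto (fun x => W x - W a) (𝓝 a) (𝓝 (W a - W a)) :=
      (hd.self_of_nhds.continuousAt.tendsto).sub_const _
    rw [sub_self] at this
    exact this.mono_left nhdsWithin_le_nhds
  · have : Tendsto (fun x : ℝ => (x - a) ^ 2) (𝓝 a) (𝓝 ((a - a) ^ 2)) := by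
      apply Continuous.tendsto; fun_prop
    simp only [sub_self, ne_eq, OfNat.ofNat_ne_zero, not_false_eq_true, zero_pow] at this
    exact this.mono_left nhdsWithin_le_nhds
  · have := (hasDerivAt_iff_tendsto_slope.mp h2.hasDerivAt).div_const 2
    refine this.congr fun x => ?_
    rw [slope_def_field, h0, sub_zero, div_div, mul_comm]

/-- A quadratic lower bound near a nondegenerate critical point with value `0`. -/
lemma exists_quadratic_lower_bound {φ : ℝ → ℝ} {a σ : ℝ} (hσ : 0 < σ) (h0 : φ a = 0)
    (hq : Tendsto (fun x => φ x / (x - a) ^ 2) (𝓝[≠] a) (𝓝 (σ / 2))) :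
    ∀ᶠ x in 𝓝 a, σ / 4 * (x - a) ^ 2 ≤ φ x := by
  have h := hq.eventually (lt_mem_nhds (show σ / 4 < σ / 2 by linarith))
  rw [eventually_nhdsWithin_iff] at h
  filter_upwards [h] with x hx
  rcases eq_or_ne x a with rfl | hne
  · simp [h0]
  · have := hx hne
    have hp : 0 < (x - a) ^ 2 := by have := sub_ne_zero.mpr hne; positivity
    rw [lt_div_iff₀ hp] at this
    exact this.le

lemma sqrt_mul_integral_eq_integral_rescaled (g : ℝ → ℝ) (a : ℝ) (n : ℕ) :
    ∫ t, g (a + t / √n) = √n * ∫ x, g x := by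
  rw [Measure.integral_comp_div (fun y => g (a + y)) (√n), integral_add_left_eq_self g a,
    abs_of_nonneg (sqrt_nonneg _), smul_eq_mul]

lemma tendsto_add_div_sqrt_nat (a t : ℝ) :
    Tendsto (fun n : ℕ => a + t / √n) atTop (𝓝 a) := by
  have h : Tendsto (fun n : ℕ => √(n : ℝ)) atTop atTop :=
    tendsto_sqrt_atTop.comp tendsto_natCast_atTop_atTop
  simpa using (h.const_div_atTop t).const_add a

lemma tendsto_mul_rescaled_quadratic {φ : ℝ → ℝ} {a σ : ℝ} (h0 : φ a = 0)
    (hq : Tendsto (fun x => φ x / (x - a) ^ 2) (𝓝[≠] a) (𝓝 (σ / 2))) (t : ℝ) :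
    Tendsto (fun n : ℕ => (n : ℝ) * φ (a + t / √n)) atTop (𝓝 (σ / 2 * t ^ 2)) := by
  rcases eq_or_ne t 0 with rfl | ht
  · simp [h0]
  have hx : Tendsto (fun n : ℕ => a + t / √n) atTop (𝓝[≠] a) := by
    refine tendsto_nhdsWithin_iff.mpr ⟨tendsto_add_div_sqrt_nat a t, ?_⟩
    filter_upwards [eventually_gt_atTop 0] with n hn
    have : 0 < √(n : ℝ) := sqrt_pos.mpr (by exact_mod_cast hn)
    simp [ht, this.ne']
  refine ((hq.comp hx).mul_const (t ^ 2)).congr' ?_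
  filter_upwards [eventually_gt_atTop 0] with n hn
  have hn' : (0 : ℝ) < n := by exact_mod_cast hn
  simp only [Function.comp, add_sub_cancel_left, div_pow, sq_sqrt hn'.le]
  field_simp

/-- Contribution of a small ball around the minimizer to a Laplace integral. -/
lemma tendsto_laplace_ball {φ w f : ℝ → ℝ} {a σ δ M C : ℝ} {n₀ : ℕ} (hσ : 0 < σ) (hδ : 0 < δ)
    (h0 : φ a = 0) (hq : Tendsto (fun x => φ x / (x - a) ^ 2) (𝓝[≠] a) (𝓝 (σ / 2)))
    (hlow : ∀ x ∈ Metric.ball a δ, σ / 4 * (x - a) ^ 2 ≤ φ x)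
    (hw : ContinuousAt w a) (hwC : ∀ x ∈ Metric.ball a δ, |w x| ≤ C)
    (hf : Continuous f) (hfM : ∀ x, |f x| ≤ M)
    (hint : ∀ n : ℕ, n₀ ≤ n →
      IntegrableOn (fun x => exp (-(n : ℝ) * φ x) * w x) (Metric.ball a δ)) :
    Tendsto (fun n : ℕ => √n * ∫ x in Metric.ball a δ,
        f (√n * (x - a)) * (exp (-(n : ℝ) * φ x) * w x)) atTop
      (𝓝 (w a * ∫ t, f t * exp (-(σ / 2) * t ^ 2))) := by
  have hM : 0 ≤ M := (abs_nonneg _).trans (hfM 0)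
  have hC : 0 ≤ C := (abs_nonneg _).trans (hwC a (Metric.mem_ball_self hδ))
  let H : ℕ → ℝ → ℝ := fun n => (Metric.ball a δ).indicator
    (fun x => f (√n * (x - a)) * (exp (-(n : ℝ) * φ x) * w x))
  have hH : ∀ n, n₀ ≤ n → Integrable (H n) := fun n hn => by
    refine (integrable_indicator_iff Metric.isOpen_ball.measurableSet).mpr ?_
    exact (hint n hn).bdd_mul (c := M)
      (by apply Continuous.aestronglyMeasurable; fun_prop) (Eventually.of_forall fun x => hfM _)
  have key : Tendsto (fun n : ℕ => ∫ t, H n (a + t / √n)) atTop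
      (𝓝 (∫ t, w a * (f t * exp (-(σ / 2) * t ^ 2)))) := by
    refine tendsto_integral_filter_of_dominated_convergence
      (fun t => M * C * exp (-(σ / 4) * t ^ 2)) ?_ ?_ ?_ ?_
    · filter_upwards [eventually_gt_atTop 0, eventually_ge_atTop n₀] with n hn hn0
      have hs : √(n : ℝ) ≠ 0 := (sqrt_pos.mpr (by exact_mod_cast hn)).ne'
      exact (((hH n hn0).comp_add_left a).comp_div hs).aestronglyMeasurable
    · filter_upwards [eventually_gt_atTop 0] with n hn
      refine Eventually.of_forall fun t => ?_
      have hn' : (0 : ℝ) < n := by exact_mod_cast hn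
      by_cases hb : a + t / √n ∈ Metric.ball a δ
      · have h1 := hlow _ hb
        rw [add_sub_cancel_left, div_pow, sq_sqrt hn'.le] at h1
        have h2 : -(n : ℝ) * φ (a + t / √n) ≤ -(σ / 4) * t ^ 2 := by
          have := mul_le_mul_of_nonneg_left h1 hn'.le
          have e : (n : ℝ) * (σ / 4 * (t ^ 2 / n)) = σ / 4 * t ^ 2 := by field_simp
          linarith
        simp only [H, Set.indicator_of_mem hb, norm_eq_abs, abs_mul, abs_exp]
        calc _ ≤ M * (exp (-(σ / 4) * t ^ 2) * C) := by
              gcongr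
              · exact hfM _
              · exact hwC _ hb
          _ = _ := by ring
      · simp only [H, Set.indicator_of_notMem hb, norm_zero]
        positivity
    · exact (integrable_exp_neg_mul_sq (by positivity)).const_mul _
    · refine Eventually.of_forall fun t => ?_
      have hx := tendsto_add_div_sqrt_nat a t
      have h1 := tendsto_mul_rescaled_quadratic h0 hq t
      have h2 := ((continuous_exp.tendsto _).comp h1.neg).mul (hw.tendsto.comp hx)
      have h3 := h2.const_mul (f t)
      have e : f t * (exp (-(σ / 2 * t ^ 2)) * w a) = w a * (f t * exp (-(σ / 2) * t ^ 2)) := by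
        rw [neg_mul]; ring
      rw [e] at h3
      refine h3.congr' ?_
      filter_upwards [eventually_gt_atTop 0, hx.eventually (Metric.ball_mem_nhds a hδ)] with n hn hb
      have hs : √(n : ℝ) ≠ 0 := (sqrt_pos.mpr (by exact_mod_cast hn)).ne'
      have hb' : a + t / √n ∈ Metric.ball a δ := hb
      simp only [H, Set.indicator_of_mem hb', Function.comp, add_sub_cancel_left]
      rw [mul_div_cancel₀ _ hs, neg_mul]
  rw [integral_const_mul] at key
  refine key.congr fun n => ?_
  rw [sqrt_mul_integral_eq_integral_rescaled,
    integral_indicator Metric.isOpen_ball.measurableSet]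

/-- Away from the minimizer a Laplace integral is negligible at scale `1 / √n`. -/
lemma tendsto_laplace_compl {φ w f : ℝ → ℝ} {a η M : ℝ} {n₀ : ℕ} {T : Set ℝ}
    (hT : MeasurableSet T) (hη : 0 < η) (hgap : ∀ x ∈ T, η ≤ φ x)
    (hw0 : ∀ x ∈ T, 0 ≤ w x) (hfM : ∀ x, |f x| ≤ M)
    (hint : IntegrableOn (fun x => exp (-(n₀ : ℝ) * φ x) * w x) T) :
    Tendsto (fun n : ℕ => √n * ∫ x in T, f (√n * (x - a)) * (exp (-(n : ℝ) * φ x) * w x)) atTop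
      (𝓝 0) := by
  have hM : 0 ≤ M := (abs_nonneg _).trans (hfM 0)
  set I := ∫ x in T, exp (-(n₀ : ℝ) * φ x) * w x with hI
  have hlim : Tendsto (fun n : ℕ => (n : ℝ) * exp (-(n : ℝ) * η) * (exp (n₀ * η) * (M * I))) atTop
      (𝓝 0) := by
    have h := (tendsto_pow_mul_exp_neg_atTop_nhds_zero 1).comp
      ((tendsto_natCast_atTop_atTop (R := ℝ)).atTop_mul_const hη)
    have h' := h.mul_const (η⁻¹ * (exp (n₀ * η) * (M * I)))
    rw [zero_mul] at h'
    refine h'.congr fun n => ?_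
    simp only [Function.comp, pow_one, neg_mul]
    field_simp
  refine squeeze_zero_norm' ?_ hlim
  filter_upwards [eventually_ge_atTop n₀, eventually_ge_atTop 1] with n hn hn1
  have hn' : (n₀ : ℝ) ≤ n := by exact_mod_cast hn
  have hn1' : (1 : ℝ) ≤ n := by exact_mod_cast hn1
  have hb : ‖∫ x in T, f (√n * (x - a)) * (exp (-(n : ℝ) * φ x) * w x)‖ ≤
      ∫ x in T, M * exp (-((n : ℝ) - n₀) * η) * (exp (-(n₀ : ℝ) * φ x) * w x) := by
    refine norm_integral_le_of_norm_le (hint.const_mul _) ?_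
    filter_upwards [ae_restrict_mem hT] with x hx
    have h1 : exp (-(n : ℝ) * φ x) ≤ exp (-((n : ℝ) - n₀) * η) * exp (-(n₀ : ℝ) * φ x) := by
      rw [← exp_add, exp_le_exp]
      nlinarith [mul_le_mul_of_nonneg_left (hgap x hx) (sub_nonneg.mpr hn')]
    have h2 := hw0 x hx
    rw [norm_eq_abs, abs_mul, abs_mul, abs_exp, abs_of_nonneg h2]
    calc _ ≤ M * (exp (-((n : ℝ) - n₀) * η) * exp (-(n₀ : ℝ) * φ x) * w x) := by
          gcongr
          exact hfM _
      _ = _ := by ring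
  rw [integral_const_mul, ← hI] at hb
  have hI0 : 0 ≤ I := setIntegral_nonneg hT fun x hx => mul_nonneg (exp_pos _).le (hw0 x hx)
  rw [norm_mul, norm_of_nonneg (sqrt_nonneg _)]
  have hs : √(n : ℝ) ≤ n := by
    rw [sqrt_le_left (by linarith)]
    nlinarith
  calc √(n : ℝ) * _ ≤ n * (M * exp (-((n : ℝ) - n₀) * η) * I) := by gcongr
    _ = n * exp (-(n : ℝ) * η) * (exp (n₀ * η) * (M * I)) := by
      have : exp (-((n : ℝ) - n₀) * η) = exp (-(n : ℝ) * η) * exp (n₀ * η) := by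
        rw [← exp_add]; ring_nf
      rw [this]; ring

/-- Laplace's method at scale `1 / √n` around a nondegenerate, well-separated minimizer. -/
lemma tendsto_laplace {φ w f : ℝ → ℝ} {a σ M : ℝ} {n₀ : ℕ} {S : Set ℝ} (hS : MeasurableSet S)
    (hSa : S ∈ 𝓝 a) (hσ : 0 < σ) (h0 : φ a = 0)
    (hq : Tendsto (fun x => φ x / (x - a) ^ 2) (𝓝[≠] a) (𝓝 (σ / 2)))
    (hgap : ∀ δ > 0, ∃ η > 0, ∀ x ∈ S, δ ≤ |x - a| → η ≤ φ x)
    (hw : ContinuousAt w a) (hw0 : ∀ x ∈ S, 0 ≤ w x)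
    (hf : Continuous f) (hfM : ∀ x, |f x| ≤ M)
    (hint : ∀ n : ℕ, n₀ ≤ n → IntegrableOn (fun x => exp (-(n : ℝ) * φ x) * w x) S) :
    Tendsto (fun n : ℕ => √n * ∫ x in S, f (√n * (x - a)) * (exp (-(n : ℝ) * φ x) * w x)) atTop
      (𝓝 (w a * ∫ t, f t * exp (-(σ / 2) * t ^ 2))) := by
  have hwb : ∀ᶠ x in 𝓝 a, |w x| ≤ |w a| + 1 :=
    (hw.abs.eventually (gt_mem_nhds (lt_add_one _))).mono fun x hx => le_of_lt hx
  obtain ⟨δ, hδ, hball⟩ := Metric.eventually_nhds_iff_ball.mp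
    ((exists_quadratic_lower_bound hσ h0 hq).and (hwb.and hSa))
  obtain ⟨η, hη, hηS⟩ := hgap δ hδ
  have hBS : Metric.ball a δ ⊆ S := fun x hx => (hball x hx).2.2
  have hB := tendsto_laplace_ball hσ hδ h0 hq (fun x hx => (hball x hx).1) hw
    (fun x hx => (hball x hx).2.1) hf hfM (fun n hn => (hint n hn).mono_set hBS)
  have hC := tendsto_laplace_compl (a := a) (f := f) (T := S \ Metric.ball a δ)
    (hS.diff Metric.isOpen_ball.measurableSet) hη
    (fun x hx => hηS x hx.1 (by simpa [Real.dist_eq] using hx.2)) (fun x hx => hw0 x hx.1) hfM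
    ((hint n₀ le_rfl).mono_set Set.sdiff_subset)
  have := hB.add hC
  rw [add_zero] at this
  refine this.congr' ?_
  filter_upwards [eventually_ge_atTop n₀] with n hn
  have hi : IntegrableOn (fun x => f (√n * (x - a)) * (exp (-(n : ℝ) * φ x) * w x)) S :=
    (hint n hn).bdd_mul (c := M)
      (by apply Continuous.aestronglyMeasurable; fun_prop) (Eventually.of_forall fun x => hfM _)
  rw [← mul_add]
  congr 1
  conv_rhs => rw [← Set.union_sdiff_cancel hBS]
  rw [setIntegral_union Set.disjoint_sdiff_right
    (hS.diff Metric.isOpen_ball.measurableSet) (hi.mono_set hBS) (hi.mono_set Set.sdiff_subset)]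

/-- A continuous function on `(0, ∞)` tending to `∞` at both ends is separated from its minimum
away from a unique minimizer. -/
lemma exists_gap_of_unique_min {W : ℝ → ℝ} {a : ℝ} (hc : ContinuousOn W (Set.Ioi 0))
    (hzero : Tendsto W (𝓝[>] 0) atTop) (htop : Tendsto W atTop atTop)
    (hmin : ∀ z, 0 < z → z ≠ a → W a < W z) {δ : ℝ} (hδ : 0 < δ) :
    ∃ η > 0, ∀ x ∈ Set.Ioi (0 : ℝ), δ ≤ |x - a| → η ≤ W x - W a := by
  obtain ⟨u, hu, hu'⟩ := mem_nhdsGT_iff_exists_Ioo_subset.mp (hzero.eventually_ge_atTop (W a + 1))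
  obtain ⟨R, hR⟩ := eventually_atTop.mp (htop.eventually_ge_atTop (W a + 1))
  let K := Set.Icc u R ∩ {x | δ ≤ |x - a|}
  have hK : IsCompact K := isCompact_Icc.inter_right (isClosed_le (by fun_prop) (by fun_prop))
  have hK0 : K ⊆ Set.Ioi 0 := fun x hx => lt_of_lt_of_le hu hx.1.1
  have hout : ∀ x ∈ Set.Ioi (0 : ℝ), δ ≤ |x - a| → x ∉ K → 1 ≤ W x - W a := by
    intro x hx hxa hxK
    by_cases h1 : x < u
    · have : W a + 1 ≤ W x := hu' ⟨hx, h1⟩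
      linarith
    · have h2 : R ≤ x := by
        by_contra! h
        exact hxK ⟨⟨not_lt.mp h1, h.le⟩, hxa⟩
      linarith [hR x h2]
  rcases K.eq_empty_or_nonempty with hKe | hKne
  · exact ⟨1, one_pos, fun x hx hxa => hout x hx hxa (by simp [hKe])⟩
  obtain ⟨y, hy, hyK⟩ := hK.exists_isMinOn hKne (hc.mono hK0)
  have hya : y ≠ a := by
    rintro rfl
    have : δ ≤ |y - y| := hy.2
    simp at this
    linarith
  refine ⟨min 1 (W y - W a), lt_min one_pos (sub_pos.mpr (hmin y (hK0 hy) hya)), ?_⟩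
  intro x hx hxa
  by_cases hxK : x ∈ K
  · exact (min_le_right _ _).trans (sub_le_sub_right (hyK hxK) _)
  · exact (min_le_left _ _).trans (hout x hx hxa hxK)

lemma tendsto_sub_log_nhdsGT_zero {V : ℝ → ℝ} (hV0 : ContinuousWithinAt V (Set.Ici 0) 0) :
    Tendsto (fun z => V z - log z) (𝓝[>] 0) atTop := by
  simp only [sub_eq_add_neg]
  exact Tendsto.add_atTop (hV0.tendsto.mono_left (nhdsWithin_mono _ Set.Ioi_subset_Ici_self))
    (tendsto_neg_atBot_atTop.comp tendsto_log_nhdsGT_zero)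

lemma tendsto_sub_log_atTop {V : ℝ → ℝ} {ε : ℝ} (hε : 0 < ε)
    (hgrowth : ∀ᶠ z in atTop, 2 + ε ≤ V z / log z) :
    Tendsto (fun z => V z - log z) atTop atTop := by
  refine tendsto_atTop_mono' _ ?_ tendsto_log_atTop
  filter_upwards [hgrowth, tendsto_log_atTop.eventually_gt_atTop 0] with z hz hl
  rw [le_div_iff₀ hl] at hz
  nlinarith

lemma integral_gaussianReal_eq_div {σ : ℝ} (hσ : 0 < σ) (f : ℝ → ℝ) :
    ∫ x, f x ∂(ProbabilityTheory.gaussianReal 0 (toNNReal (1 / σ))) =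
      (∫ t, f t * exp (-(σ / 2) * t ^ 2)) / ∫ t, exp (-(σ / 2) * t ^ 2) := by
  have h1 : (0 : ℝ) < 1 / σ := by positivity
  rw [ProbabilityTheory.integral_gaussianReal_eq_integral_smul (by simpa using hσ),
    integral_gaussian, div_eq_inv_mul (∫ t, f t * _), ← integral_const_mul]
  congr 1 with x
  rw [ProbabilityTheory.gaussianPDFReal, coe_toNNReal _ h1.le, smul_eq_mul]
  have e1 : 2 * π * (1 / σ) = π / (σ / 2) := by field_simp
  have e2 : -(x - 0) ^ 2 / (2 * (1 / σ)) = -(σ / 2) * x ^ 2 := by field_simp; ring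
  rw [e1, e2]
  ring

lemma integral_normalized_withDensity {g : ℝ → ℝ} {S : Set ℝ} (hS : MeasurableSet S)
    (hg : IntegrableOn g S) (hg0 : ∀ x ∈ S, 0 ≤ g x) (F : ℝ → ℝ) :
    ∫ x, F x ∂((ENNReal.ofReal (∫ x in S, g x))⁻¹ •
        ((volume.restrict S).withDensity fun x => ENNReal.ofReal (g x))) =
      (∫ x in S, F x * g x) / ∫ x in S, g x := by
  rw [integral_smul_measure, integral_withDensity_eq_integral_toReal_smul₀
    hg.aestronglyMeasurable.aemeasurable.ennreal_ofReal (by simp), ENNReal.toReal_inv,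
    ENNReal.toReal_ofReal (setIntegral_nonneg hS hg0), smul_eq_mul, div_eq_inv_mul]
  congr 1
  refine setIntegral_congr_fun hS fun x hx => ?_
  simp only [ENNReal.toReal_ofReal (hg0 x hx), smul_eq_mul, mul_comm]

lemma exp_neg_mul_pow_sub_eq {V : ℝ → ℝ} {x c : ℝ} (hx : 0 < x) {n r : ℕ} (hn : r ≤ n) :
    exp (-(n : ℝ) * V x) * x ^ (n - r) =
      exp (-(n : ℝ) * c) * (exp (-(n : ℝ) * (V x - log x - c)) * (x ^ r)⁻¹) := by
  have h : x ^ (n - r) = exp (n * log x) * (x ^ r)⁻¹ := by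
    rw [exp_nat_mul, exp_log hx, pow_sub₀ _ hx.ne' hn]
  rw [h, ← mul_assoc, ← mul_assoc, ← exp_add, ← exp_add]
  ring_nf

/-- One-dimensional Laplace-type CLT: if `X_n` has density proportional to
`e^{-nV(x)} x^{n-r}` on `(0,∞)`, then `√n (X_n - z*)` converges in distribution to
`N(0, 1/W''(z*))`, where `W = V - log` has unique minimizer `z*`. -/
theorem statement17 (V : ℝ → ℝ)
    (hVd : ContDiffOn ℝ 2 V (Set.Ioi 0)) (hV0 : ContinuousWithinAt V (Set.Ici 0) 0)
    (ε : ℝ) (hε : 0 < ε) (hgrowth : ∀ᶠ z in atTop, 2 + ε ≤ V z / Real.log z)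
    (W : ℝ → ℝ) (hW : W = fun z => V z - Real.log z)
    (zs : ℝ) (hzs : 0 < zs) (hmin : ∀ z, 0 < z → z ≠ zs → W zs < W z)
    (hW'' : 0 < deriv (deriv W) zs)
    (r : ℕ) (hr : 1 ≤ r)
    (μ : ℕ → Measure ℝ)
    (hint : ∀ n : ℕ, r < n →
      IntegrableOn (fun x => Real.exp (-(n : ℝ) * V x) * x ^ (n - r)) (Set.Ioi 0))
    (hμ : ∀ n : ℕ, r < n → μ n =
      (ENNReal.ofReal (∫ x in Set.Ioi (0 : ℝ), Real.exp (-(n : ℝ) * V x) * x ^ (n - r)))⁻¹ •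
        ((volume.restrict (Set.Ioi 0)).withDensity
          (fun x => ENNReal.ofReal (Real.exp (-(n : ℝ) * V x) * x ^ (n - r))))) :
    ∀ f : BoundedContinuousFunction ℝ ℝ,
      Tendsto (fun n : ℕ => ∫ x, f (Real.sqrt n * (x - zs)) ∂(μ n)) atTop
        (𝓝 (∫ x, f x ∂(ProbabilityTheory.gaussianReal 0 (Real.toNNReal (1 / deriv (deriv W) zs))))) := by
  intro f
  have hWd : ContDiffOn ℝ 2 W (Set.Ioi 0) := by
    rw [hW]
    exact hVd.sub (contDiffOn_log.mono fun x hx => (Set.mem_Ioi.mp hx).ne')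
  have hnhds : Set.Ioi (0 : ℝ) ∈ 𝓝 zs := Ioi_mem_nhds hzs
  have hdiff : ∀ᶠ x in 𝓝 zs, DifferentiableAt ℝ W x := by
    filter_upwards [hnhds] with x hx
    exact (hWd.differentiableOn (by norm_num)).differentiableAt (Ioi_mem_nhds hx)
  have hcrit : deriv W zs = 0 := by
    refine IsLocalMin.deriv_eq_zero ?_
    filter_upwards [hnhds] with x hx
    rcases eq_or_ne x zs with rfl | hne
    · exact le_rfl
    · exact (hmin x hx hne).le
  have hq := tendsto_sub_div_sq_of_deriv_eq_zero hdiff hcrit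
    (differentiableAt_of_deriv_ne_zero hW''.ne')
  set σ := deriv (deriv W) zs with hσ
  have hrep : ∀ n : ℕ, r < n → ∀ x ∈ Set.Ioi (0 : ℝ), exp (-(n : ℝ) * V x) * x ^ (n - r) =
      exp (-(n : ℝ) * W zs) * (exp (-(n : ℝ) * (W x - W zs)) * (x ^ r)⁻¹) := by
    intro n hn x hx
    rw [hW]
    exact exp_neg_mul_pow_sub_eq hx hn.le
  have hint' : ∀ n : ℕ, r + 1 ≤ n →
      IntegrableOn (fun x => exp (-(n : ℝ) * (W x - W zs)) * (x ^ r)⁻¹) (Set.Ioi 0) := by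
    intro n hn
    have h := (hint n hn).congr_fun (hrep n hn) measurableSet_Ioi
    exact (integrable_const_mul_iff (exp_pos _).ne'.isUnit _).mp h
  have hgap : ∀ δ > 0, ∃ η > 0, ∀ x ∈ Set.Ioi (0 : ℝ), δ ≤ |x - zs| → η ≤ W x - W zs := by
    intro δ hδ
    refine exists_gap_of_unique_min hWd.continuousOn ?_ ?_ hmin hδ
    · rw [hW]
      exact tendsto_sub_log_nhdsGT_zero hV0
    · rw [hW]
      exact tendsto_sub_log_atTop hε hgrowth
  have hw : ContinuousAt (fun x : ℝ => (x ^ r)⁻¹) zs :=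
    (continuous_pow r).continuousAt.inv₀ (pow_pos hzs r).ne'
  have hw0 : ∀ x ∈ Set.Ioi (0 : ℝ), 0 ≤ (x ^ r)⁻¹ := fun x hx =>
    inv_nonneg.mpr (pow_nonneg (le_of_lt hx) r)
  have hnum := tendsto_laplace measurableSet_Ioi hnhds hW'' (sub_self (W zs)) hq hgap hw hw0
    f.continuous f.norm_coe_le_norm hint'
  have hden := tendsto_laplace (f := fun _ => (1 : ℝ)) (M := 1) measurableSet_Ioi hnhds hW''
    (sub_self (W zs)) hq hgap hw hw0 continuous_const (by simp) hint'
  simp only [one_mul] at hden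
  have hG : 0 < ∫ t, exp (-(σ / 2) * t ^ 2) := by
    rw [integral_gaussian]
    have := pi_pos
    positivity
  have hwpos : 0 < (zs ^ r)⁻¹ := by positivity
  have hlim := hnum.div hden (mul_pos hwpos hG).ne'
  rw [mul_div_mul_left _ _ hwpos.ne', ← integral_gaussianReal_eq_div hW''] at hlim
  refine hlim.congr' ?_
  filter_upwards [eventually_gt_atTop r] with n hn
  have hsn : √(n : ℝ) ≠ 0 := (sqrt_pos.mpr (by exact_mod_cast Nat.zero_lt_of_lt hn)).ne'
  rw [hμ n hn, integral_normalized_withDensity measurableSet_Ioi (hint n hn)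
    (fun x hx => mul_nonneg (exp_pos _).le (pow_nonneg (le_of_lt hx) _)),
    setIntegral_congr_fun measurableSet_Ioi (hrep n hn),
    setIntegral_congr_fun (g := fun x => exp (-(n : ℝ) * W zs) *
      (f (√n * (x - zs)) * (exp (-(n : ℝ) * (W x - W zs)) * (x ^ r)⁻¹))) measurableSet_Ioi
      (fun x hx => by simp only [hrep n hn x hx]; ring),
    integral_const_mul, integral_const_mul, mul_div_mul_left _ _ (exp_pos _).ne']
  exact mul_div_mul_left _ _ hsn

end
end

section
/- Let V ∈ C²((0,1)) be continuous at 0 and 1, and assume W(p) = V(p) − log(p(1−p)) has a unique minimizer p* ∈ (0,1) with W''(p*) > 0. Fix an integer r ≥ 1, and for each n > r let X_n be a random variable with probability density proportional to e^{−nV(x)} (x(1−x))^{n−r} on (0,1). Let (a_n)_n be a real sequence with a_n → ∞ and a_n/√n → 0, and set b_n = n/a_n². Then a_n(X_n − p*) satisfies a large deviations principle on ℝ with speed b_n and good rate function J(x) = W''(p*)·x²/2: for every closed set U ⊆ ℝ, limsup_{n→∞} (1/b_n) log ℙ(a_n(X_n − p*) ∈ U) ≤ −inf_{x∈U} J(x),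 and for every open set O ⊆ ℝ, liminf_{n→∞} (1/b_n) log ℙ(a_n(X_n − p*) ∈ O) ≥ −inf_{x∈O} J(x). -/
open MeasureTheory Real Filter Topology Polynomial

noncomputable section

/-- Second-order Taylor expansion at a local minimum. -/
lemma isLittleO_sub_quadratic_of_isLocalMin {f : ℝ → ℝ} {s : Set ℝ} {x₀ : ℝ} (hso : IsOpen s)
    (hsc : Convex ℝ s) (hx : x₀ ∈ s) (hf : ContDiffOn ℝ 2 f s) (hmin : IsLocalMin f x₀) :
    (fun x => f x - f x₀ - deriv (deriv f) x₀ / 2 * (x - x₀) ^ 2)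
      =o[𝓝 x₀] fun x => (x - x₀) ^ 2 := by
  have h := taylor_isLittleO (n := 2) hsc hx hf
  rw [hso.nhdsWithin_eq hx] at h
  have h1 : derivWithin f s x₀ = 0 := by
    rw [derivWithin_of_isOpen hso hx, hmin.deriv_eq_zero]
  have h2 : iteratedDerivWithin 2 f s x₀ = deriv (deriv f) x₀ := by
    rw [iteratedDerivWithin_of_isOpen hso hx, iteratedDeriv_succ, iteratedDeriv_one]
  refine h.congr_left fun x => ?_
  rw [taylorWithinEval_succ, taylorWithinEval_succ, taylor_within_zero_eval]
  simp only [zero_add, iteratedDerivWithin_one, h1, h2, one_add_one_eq_two]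
  simp
  ring

/-- Away from its strict minimizer, `V x - log (x (1 - x))` is bounded away from its minimum. -/
lemma exists_gap {V : ℝ → ℝ} (hV : ContinuousOn V (Set.Icc 0 1)) {p₀ δ w₀ : ℝ} (hδ : 0 < δ)
    (hmin : ∀ p ∈ Set.Ioo (0 : ℝ) 1, p ≠ p₀ → w₀ < V p - log (p * (1 - p))) :
    ∃ η > 0, ∀ p ∈ Set.Ioo (0 : ℝ) 1, δ ≤ |p - p₀| → w₀ + η ≤ V p - log (p * (1 - p)) := by
  set g : ℝ → ℝ := fun x => exp (w₀ - V x) * (x * (1 - x)) with hg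
  have hgc : ContinuousOn g (Set.Icc 0 1) := by
    apply ContinuousOn.mul
    · exact (continuousOn_const.sub hV).rexp
    · fun_prop
  have hglog : ∀ p ∈ Set.Ioo (0 : ℝ) 1, g p = exp (w₀ - (V p - log (p * (1 - p)))) := by
    intro p hp
    have : 0 < p * (1 - p) := mul_pos hp.1 (by linarith [hp.2])
    rw [← sub_add, exp_add, exp_log this]
  set K : Set ℝ := Set.Icc 0 1 ∩ {x | δ ≤ |x - p₀|} with hK
  have hKc : IsCompact K := isCompact_Icc.inter_right
    (isClosed_le continuous_const (by fun_prop))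
  rcases K.eq_empty_or_nonempty with hKe | hKn
  · refine ⟨1, one_pos, fun p hp hpd => ?_⟩
    have : p ∈ K := ⟨Set.Ioo_subset_Icc_self hp, hpd⟩
    simp [hKe] at this
  obtain ⟨x, hxK, hx⟩ := hKc.exists_isMaxOn hKn (hgc.mono Set.inter_subset_left)
  have hg1 : g x < 1 := by
    by_cases hx01 : x ∈ Set.Ioo (0 : ℝ) 1
    · have hxp : x ≠ p₀ := by
        rintro rfl
        have := hxK.2
        simp at this
        linarith
      rw [hglog x hx01, exp_lt_one_iff]
      linarith [hmin x hx01 hxp]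
    · have : x = 0 ∨ x = 1 := by
        by_contra! h
        exact hx01 ⟨lt_of_le_of_ne hxK.1.1 h.1.symm, lt_of_le_of_ne hxK.1.2 h.2⟩
      rcases this with rfl | rfl <;> simp [hg]
  set q := max (g x) (1 / 2) with hq
  have hq0 : 0 < q := lt_of_lt_of_le (by norm_num) (le_max_right _ _)
  have hq1 : q < 1 := max_lt hg1 (by norm_num)
  refine ⟨-log q, by linarith [log_neg hq0 hq1], fun p hp hpd => ?_⟩
  have hpq : g p ≤ q := (hx ⟨Set.Ioo_subset_Icc_self hp, hpd⟩ : g p ≤ g x).trans (le_max_left _ _)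
  rw [hglog p hp, ← le_log_iff_exp_le hq0] at hpq
  linarith

/-- Exponential upper bounds pass to the normalized logarithms. -/
lemma limsup_mul_log_le {s : ℕ → ℝ} {m : ℕ → ENNReal} {C L : ℝ} (hC : 0 < C)
    (hs : Tendsto s atTop (𝓝 0)) (hs0 : ∀ᶠ n in atTop, 0 < s n)
    (hm : ∀ᶠ n in atTop, m n ≤ ENNReal.ofReal (C * exp (-(L / s n)))) :
    limsup (fun n => (s n : EReal) * ENNReal.log (m n)) atTop ≤ ((-L : ℝ) : EReal) := by
  have ht : Tendsto (fun n => ((s n * log C - L : ℝ) : EReal)) atTop (𝓝 ((-L : ℝ) : EReal)) := by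
    refine (continuous_coe_real_ereal.tendsto _).comp ?_
    simpa using (hs.mul_const (log C)).sub_const L
  rw [← ht.limsup_eq]
  refine limsup_le_limsup ?_
  filter_upwards [hs0, hm] with n h0 h1
  have h2 : s n * log C - L = s n * log (C * exp (-(L / s n))) := by
    rw [log_mul hC.ne' (exp_pos _).ne', log_exp]
    field_simp
    ring
  rw [h2, EReal.coe_mul, ← ENNReal.log_ofReal_of_pos (by positivity)]
  exact mul_le_mul_of_nonneg_left (ENNReal.log_le_log h1) (by exact_mod_cast h0.le)

/-- Exponential lower bounds pass to the normalized logarithms. -/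
lemma le_liminf_mul_log {s : ℕ → ℝ} {m : ℕ → ENNReal} {C L : ℝ} (hC : 0 < C)
    (hs : Tendsto s atTop (𝓝 0)) (hs0 : ∀ᶠ n in atTop, 0 < s n)
    (hm : ∀ᶠ n in atTop, ENNReal.ofReal (C * exp (-(L / s n))) ≤ m n) :
    ((-L : ℝ) : EReal) ≤ liminf (fun n => (s n : EReal) * ENNReal.log (m n)) atTop := by
  have ht : Tendsto (fun n => ((s n * log C - L : ℝ) : EReal)) atTop (𝓝 ((-L : ℝ) : EReal)) := by
    refine (continuous_coe_real_ereal.tendsto _).comp ?_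
    simpa using (hs.mul_const (log C)).sub_const L
  rw [← ht.liminf_eq]
  refine liminf_le_liminf ?_
  filter_upwards [hs0, hm] with n h0 h1
  have h2 : s n * log C - L = s n * log (C * exp (-(L / s n))) := by
    rw [log_mul hC.ne' (exp_pos _).ne', log_exp]
    field_simp
    ring
  rw [h2, EReal.coe_mul, ← ENNReal.log_ofReal_of_pos (by positivity)]
  exact mul_le_mul_of_nonneg_left (ENNReal.log_le_log h1) (by exact_mod_cast h0.le)

lemma lintegral_exp_neg_mul_sub_sq {c : ℝ} (hc : 0 < c) (p : ℝ) :
    ∫⁻ x, ENNReal.ofReal (exp (-c * (x - p) ^ 2)) = ENNReal.ofReal (√(π / c)) := by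
  rw [lintegral_sub_right_eq_self (fun x => ENNReal.ofReal (exp (-c * x ^ 2))) p,
    ← ofReal_integral_eq_lintegral_ofReal (integrable_exp_neg_mul_sq hc)
      (ae_of_all _ fun _ => (exp_pos _).le), integral_gaussian]

/-- Gaussian domination of the density bounds the mass of a set from above. -/
lemma withDensity_le_of_gaussian {f : ℝ → ℝ} {A S : Set ℝ} (hA : MeasurableSet A)
    (hS : MeasurableSet S) {D c p : ℝ} (hD : 0 ≤ D) (hc : 0 < c)
    (hf : ∀ x ∈ S, x ∈ A → f x ≤ D * exp (-c * (x - p) ^ 2)) :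
    (volume.restrict S).withDensity (fun x => ENNReal.ofReal (f x)) A
      ≤ ENNReal.ofReal (D * √(π / c)) := by
  rw [withDensity_apply _ hA, Measure.restrict_restrict hA, ENNReal.ofReal_mul hD,
    ← lintegral_exp_neg_mul_sub_sq hc p, ← lintegral_const_mul _ (by fun_prop)]
  refine (setLIntegral_mono' (hA.inter hS) fun x hx => ?_).trans (setLIntegral_le_lintegral _ _)
  rw [← ENNReal.ofReal_mul hD]
  exact ENNReal.ofReal_le_ofReal (hf x hx.2 hx.1)

/-- A lower bound of the density on an interval bounds the mass of a set from below. -/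
lemma le_withDensity_of_Ioo {f : ℝ → ℝ} {A S : Set ℝ} (hA : MeasurableSet A)
    {D u v : ℝ} (hD : 0 ≤ D) (huA : Set.Ioo u v ⊆ A) (huS : Set.Ioo u v ⊆ S)
    (hf : ∀ x ∈ Set.Ioo u v, D ≤ f x) :
    ENNReal.ofReal (D * (v - u))
      ≤ (volume.restrict S).withDensity (fun x => ENNReal.ofReal (f x)) A := by
  rw [withDensity_apply _ hA, Measure.restrict_restrict hA, ENNReal.ofReal_mul hD,
    ← Real.volume_Ioo, ← setLIntegral_const]
  refine (setLIntegral_mono' measurableSet_Ioo fun x hx => ?_).trans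
    (lintegral_mono_set (Set.subset_inter huA huS))
  exact ENNReal.ofReal_le_ofReal (hf x hx)

section Normalization

variable {α : Type*} [MeasurableSpace α] {μ ν : Measure α} {c : ℝ}

lemma apply_univ_of_eq_inv_smul (hc : 0 < c) (hμ : μ = (ENNReal.ofReal c)⁻¹ • ν)
    [IsProbabilityMeasure μ] : ν Set.univ = ENNReal.ofReal c := by
  have h : μ Set.univ = 1 := measure_univ
  rw [hμ, Measure.smul_apply, smul_eq_mul, mul_comm, ← div_eq_mul_inv] at h
  have hc' : ENNReal.ofReal c ≠ 0 := by simpa using hc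
  rw [ENNReal.div_eq_one_iff hc' ENNReal.ofReal_ne_top] at h
  exact h

lemma normalized_apply_le (hc : 0 < c) (hμ : μ = (ENNReal.ofReal c)⁻¹ • ν)
    [IsProbabilityMeasure μ] {A : Set α} {a b : ℝ} (ha : 0 < a) (hb : 0 ≤ b)
    (hν : ENNReal.ofReal a ≤ ν Set.univ) (hA : ν A ≤ ENNReal.ofReal b) :
    μ A ≤ ENNReal.ofReal (b / a) := by
  rw [apply_univ_of_eq_inv_smul hc hμ, ENNReal.ofReal_le_ofReal_iff hc.le] at hν
  rw [hμ, Measure.smul_apply, smul_eq_mul, ← ENNReal.ofReal_inv_of_pos hc]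
  calc ENNReal.ofReal c⁻¹ * ν A ≤ ENNReal.ofReal c⁻¹ * ENNReal.ofReal b := by gcongr
    _ = ENNReal.ofReal (b / c) := by
      rw [← ENNReal.ofReal_mul (by positivity), div_eq_inv_mul]
    _ ≤ ENNReal.ofReal (b / a) := by gcongr

lemma le_normalized_apply (hc : 0 < c) (hμ : μ = (ENNReal.ofReal c)⁻¹ • ν)
    [IsProbabilityMeasure μ] {A : Set α} {a b : ℝ} (hb : 0 ≤ b) (ha : 0 ≤ a)
    (hν : ν Set.univ ≤ ENNReal.ofReal a) (hA : ENNReal.ofReal b ≤ ν A) :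
    ENNReal.ofReal (b / a) ≤ μ A := by
  rw [apply_univ_of_eq_inv_smul hc hμ, ENNReal.ofReal_le_ofReal_iff ha] at hν
  rw [hμ, Measure.smul_apply, smul_eq_mul, ← ENNReal.ofReal_inv_of_pos hc]
  calc ENNReal.ofReal (b / a) ≤ ENNReal.ofReal (b / c) := by gcongr
    _ = ENNReal.ofReal c⁻¹ * ENNReal.ofReal b := by
      rw [← ENNReal.ofReal_mul (by positivity), div_eq_inv_mul]
    _ ≤ ENNReal.ofReal c⁻¹ * ν A := by gcongr

end Normalization

/-- Two-sided exponential control of the densities `F n` on `(0,1)`, with an exponent `w` that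
is locally asymptotic to `σ / 2 * (x - p) ^ 2` and globally at least `κ * (x - p) ^ 2`. -/
structure QuadraticDensity (F : ℕ → ℝ → ℝ) (w : ℝ → ℝ) (B : ℕ → ℝ)
    (p σ κ m M : ℝ) (r : ℕ) : Prop where
  σ_pos : 0 < σ
  κ_pos : 0 < κ
  m_pos : 0 < m
  M_pos : 0 < M
  B_pos : ∀ n, 0 < B n
  lower : ∀ n, r < n → ∀ x ∈ Set.Ioo (0 : ℝ) 1, B n * m * exp (-(n * w x)) ≤ F n x
  upper : ∀ n, r < n → ∀ x ∈ Set.Ioo (0 : ℝ) 1, F n x ≤ B n * M * exp (-((n - r) * w x))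
  glob : ∀ x ∈ Set.Ioo (0 : ℝ) 1, κ * (x - p) ^ 2 ≤ w x
  loc : ∀ ε > 0, ∃ δ > 0, ∀ x, |x - p| < δ →
    x ∈ Set.Ioo (0 : ℝ) 1 ∧ |w x - σ / 2 * (x - p) ^ 2| ≤ ε * (x - p) ^ 2

namespace QuadraticDensity

variable {F : ℕ → ℝ → ℝ} {w : ℝ → ℝ} {B : ℕ → ℝ} {p σ κ m M : ℝ} {r : ℕ}

lemma eventually_mul_le (r : ℕ) {θ : ℝ} (hθ : θ < 1) :
    ∀ᶠ n : ℕ in atTop, r < n ∧ 0 < (n : ℝ) ∧ θ * n ≤ (n : ℝ) - r := by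
  filter_upwards [eventually_gt_atTop r,
    (tendsto_natCast_atTop_atTop (R := ℝ)).eventually_ge_atTop (r / (1 - θ))] with n h1 h2
  refine ⟨h1, by exact_mod_cast (Nat.zero_le r).trans_lt h1, ?_⟩
  rw [div_le_iff₀ (by linarith)] at h2
  linarith

lemma eventually_mass_ge (h : QuadraticDensity F w B p σ κ m M r) : ∀ᶠ n : ℕ in atTop,
    ENNReal.ofReal (B n * m * exp (-σ) * (2 / √n)) ≤
      ((volume.restrict (Set.Ioo 0 1)).withDensity fun x => ENNReal.ofReal (F n x)) Set.univ := by
  obtain ⟨δ, hδ, hloc⟩ := h.loc (σ / 2) (half_pos h.σ_pos)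
  have hlim : Tendsto (fun n : ℕ => 1 / √(n : ℝ)) atTop (𝓝 0) :=
    (tendsto_const_nhds.div_atTop (tendsto_sqrt_atTop.comp tendsto_natCast_atTop_atTop))
  filter_upwards [hlim.eventually_lt_const hδ, eventually_gt_atTop r] with n hn hr
  have hn0 : 0 < (n : ℝ) := by exact_mod_cast (Nat.zero_le r).trans_lt hr
  have hx : ∀ x ∈ Set.Ioo (p - 1 / √n) (p + 1 / √n), |x - p| < 1 / √n := by
    intro x hx
    rw [abs_lt]
    constructor <;> linarith [hx.1, hx.2]
  convert le_withDensity_of_Ioo (f := F n) (S := Set.Ioo 0 1) (A := Set.univ)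
    (D := B n * m * exp (-σ)) (u := p - 1 / √n) (v := p + 1 / √n) MeasurableSet.univ
    ?_ (Set.subset_univ _) ?_ ?_ using 3
  · ring
  · have := h.B_pos n
    have := h.m_pos
    positivity
  · exact fun x hx' => (hloc x ((hx x hx').trans hn)).1
  · intro x hx'
    have h1 := hx x hx'
    obtain ⟨h2, h3⟩ := hloc x (h1.trans hn)
    refine le_trans ?_ (h.lower n hr x h2)
    have := h.B_pos n
    have := h.m_pos
    gcongr
    have h4 : (x - p) ^ 2 ≤ 1 / (n : ℝ) := by
      rw [← sq_abs]
      calc |x - p| ^ 2 ≤ (1 / √n) ^ 2 := by gcongr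
        _ = 1 / (n : ℝ) := by rw [div_pow, sq_sqrt hn0.le, one_pow]
    have h5 : w x ≤ σ * (x - p) ^ 2 := by linarith [(abs_le.1 h3).2]
    calc (n : ℝ) * w x ≤ n * (σ * (1 / n)) := by
          gcongr
          exact h5.trans (mul_le_mul_of_nonneg_left h4 h.σ_pos.le)
      _ = σ := by field_simp

lemma eventually_mass_le (h : QuadraticDensity F w B p σ κ m M r) : ∀ᶠ n : ℕ in atTop,
    ((volume.restrict (Set.Ioo 0 1)).withDensity fun x => ENNReal.ofReal (F n x)) Set.univ
      ≤ ENNReal.ofReal (B n * M * (√(π / (κ / 2)) / √n)) := by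
  filter_upwards [eventually_mul_le r (show (1 / 2 : ℝ) < 1 by norm_num)] with n ⟨hr, hn0, hn⟩
  have hκ := h.κ_pos
  rw [← sqrt_div (by positivity), div_div]
  refine withDensity_le_of_gaussian (p := p) MeasurableSet.univ measurableSet_Ioo
    (mul_pos (h.B_pos n) h.M_pos).le (by positivity) fun x hx _ => (h.upper n hr x hx).trans ?_
  have := h.B_pos n
  have := h.M_pos
  gcongr
  have h1 : 0 ≤ κ * (x - p) ^ 2 := by positivity
  have h2 := h.glob x hx
  nlinarith

lemma upper_bound (h : QuadraticDensity F w B p σ κ m M r) {μ : ℕ → Measure ℝ} {a : ℕ → ℝ}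
    (hprob : ∀ n : ℕ, r < n → IsProbabilityMeasure (μ n))
    (hμ : ∀ n : ℕ, r < n → ∃ c : ℝ, 0 < c ∧ μ n = (ENNReal.ofReal c)⁻¹ •
      ((volume.restrict (Set.Ioo 0 1)).withDensity fun x => ENNReal.ofReal (F n x)))
    (ha : Tendsto a atTop atTop) {t θ : ℝ} (hθ0 : 0 < θ) (hθ1 : θ < 1) :
    ∃ C > 0, ∀ᶠ n : ℕ in atTop, ∀ A, MeasurableSet A → (∀ x ∈ A, t ≤ |a n * (x - p)|) → 0 < t →
      μ n A ≤ ENNReal.ofReal (C * exp (-(θ ^ 2 * (σ * t ^ 2 / 2) / (a n ^ 2 / n)))) := by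
  have hκ := h.κ_pos
  have hm := h.m_pos
  have hM := h.M_pos
  have hσ := h.σ_pos
  set κ' := (1 - θ) / 2 * κ with hκ'
  have hκ'0 : 0 < κ' := mul_pos (by linarith) hκ
  refine ⟨M * √(π / κ') / (m * exp (-σ) * 2), by positivity, ?_⟩
  obtain ⟨δ, hδ, hloc⟩ := h.loc ((1 - θ) * (σ / 2)) (mul_pos (by linarith) (by linarith))
  have ha2 : Tendsto (fun n => θ * (σ * t ^ 2 / 2) / a n ^ 2) atTop (𝓝 0) :=
    tendsto_const_nhds.div_atTop ((tendsto_pow_atTop two_ne_zero).comp ha)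
  filter_upwards [eventually_mul_le r (show (1 + θ) / 2 < 1 by linarith), h.eventually_mass_ge,
    ha.eventually_gt_atTop 0, ha2.eventually_lt_const (show 0 < κ * δ ^ 2 by positivity)]
    with n ⟨hr, hn0, hn⟩ hmass ha0 hsmall A hA hAt ht
  have hB := h.B_pos n
  obtain ⟨c, hc, hμc⟩ := hμ n hr
  have := hprob n hr
  have hw : ∀ x ∈ Set.Ioo (0 : ℝ) 1, x ∈ A → θ * (σ * t ^ 2 / 2) / a n ^ 2 ≤ w x := by
    intro x hx hxA
    by_cases hxδ : |x - p| < δ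
    · have h1 := (abs_le.1 (hloc x hxδ).2).1
      have h2 : θ * (σ / 2) * (x - p) ^ 2 ≤ w x := by linarith
      refine le_trans ?_ h2
      have h3 := hAt x hxA
      rw [abs_mul, abs_of_pos ha0] at h3
      have h4 : t ^ 2 ≤ a n ^ 2 * (x - p) ^ 2 := by
        rw [← sq_abs (x - p), ← mul_pow]
        gcongr
      rw [div_le_iff₀ (by positivity)]
      have : 0 < θ * (σ / 2) := by positivity
      nlinarith
    · refine hsmall.le.trans (le_trans ?_ (h.glob x hx))
      rw [← sq_abs (x - p)]
      have := not_lt.1 hxδ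
      gcongr
  have hνA := withDensity_le_of_gaussian (f := F n) (p := p) (c := κ' * n)
    (D := B n * M * exp (-(θ ^ 2 * (σ * t ^ 2 / 2) / (a n ^ 2 / n)))) hA
    (measurableSet_Ioo (a := (0 : ℝ)) (b := 1)) (by positivity) (by positivity) (by
      intro x hx hxA
      refine (h.upper n hr x hx).trans ?_
      rw [mul_assoc _ (exp _), ← exp_add]
      gcongr
      have h1 := hw x hx hxA
      have h2 := h.glob x hx
      have h0 : 0 ≤ w x := le_trans (by positivity) h2
      have h3 : θ ^ 2 * (σ * t ^ 2 / 2) / (a n ^ 2 / n)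
          = θ * n * (θ * (σ * t ^ 2 / 2) / a n ^ 2) := by
        field_simp
      have h4 : θ * n * (θ * (σ * t ^ 2 / 2) / a n ^ 2) ≤ θ * n * w x := by gcongr
      have h5 : (1 - θ) / 2 * n * (κ * (x - p) ^ 2) ≤ (1 - θ) / 2 * n * w x := by
        have : 0 < 1 - θ := by linarith
        gcongr
      have h6 : (1 + θ) / 2 * n * w x ≤ (n - r) * w x := by gcongr
      rw [h3, hκ']
      linarith)
  refine (normalized_apply_le hc hμc (by positivity) (by positivity) hmass hνA).trans_eq ?_
  congr 1
  rw [← div_div π, sqrt_div (by positivity)]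
  have : 0 < √(n : ℝ) := sqrt_pos.2 hn0
  field_simp

lemma lower_bound (h : QuadraticDensity F w B p σ κ m M r) {μ : ℕ → Measure ℝ} {a : ℕ → ℝ}
    (hprob : ∀ n : ℕ, r < n → IsProbabilityMeasure (μ n))
    (hμ : ∀ n : ℕ, r < n → ∃ c : ℝ, 0 < c ∧ μ n = (ENNReal.ofReal c)⁻¹ •
      ((volume.restrict (Set.Ioo 0 1)).withDensity fun x => ENNReal.ofReal (F n x)))
    (ha : Tendsto a atTop atTop) (ha' : Tendsto (fun n : ℕ => a n / √n) atTop (𝓝 0))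
    {O : Set ℝ} (hO : IsOpen O) {y ε : ℝ} (hy : y ∈ O) (hε : 0 < ε) :
    ∃ C > 0, ∀ᶠ n : ℕ in atTop,
      ENNReal.ofReal (C * exp (-((σ / 2 + ε) * (|y| + ε) ^ 2 / (a n ^ 2 / n))))
        ≤ μ n {x | a n * (x - p) ∈ O} := by
  have hκ := h.κ_pos
  have hm := h.m_pos
  have hM := h.M_pos
  have hσ := h.σ_pos
  obtain ⟨ρ', hρ', hball'⟩ := Metric.isOpen_iff.1 hO y hy
  set ρ := min ρ' ε with hρdef
  have hρ : 0 < ρ := lt_min hρ' hε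
  refine ⟨m * (2 * ρ) / (M * √(π / (κ / 2))), by positivity, ?_⟩
  obtain ⟨δ, hδ, hloc⟩ := h.loc ε hε
  have ha2 : Tendsto (fun n => (|y| + ε) / a n) atTop (𝓝 0) := tendsto_const_nhds.div_atTop ha
  filter_upwards [eventually_gt_atTop r, h.eventually_mass_le, ha.eventually_gt_atTop 0,
    ha2.eventually_lt_const hδ, ha'.eventually_lt_const one_pos] with n hr hmass ha0 hsmall han
  have hn0 : 0 < (n : ℝ) := by exact_mod_cast (Nat.zero_le r).trans_lt hr
  have hsn : 0 < √(n : ℝ) := sqrt_pos.2 hn0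
  have hB := h.B_pos n
  obtain ⟨c, hc, hμc⟩ := hμ n hr
  have := hprob n hr
  have hI : ∀ x ∈ Set.Ioo (p + (y - ρ) / a n) (p + (y + ρ) / a n), |a n * (x - p) - y| < ρ := by
    intro x hx
    have h1 : (y - ρ) / a n < x - p := by linarith [hx.1]
    have h2 : x - p < (y + ρ) / a n := by linarith [hx.2]
    rw [div_lt_iff₀ ha0] at h1
    rw [lt_div_iff₀ ha0] at h2
    rw [abs_lt]
    constructor <;> linarith
  have hI2 : ∀ x ∈ Set.Ioo (p + (y - ρ) / a n) (p + (y + ρ) / a n),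
      |x - p| ≤ (|y| + ε) / a n := by
    intro x hx
    rw [le_div_iff₀ ha0]
    calc |x - p| * a n = |(a n * (x - p) - y) + y| := by
          rw [sub_add_cancel, abs_mul, abs_of_pos ha0, mul_comm]
      _ ≤ |a n * (x - p) - y| + |y| := abs_add_le _ _
      _ ≤ |y| + ε := by linarith [hI x hx, min_le_right ρ' ε]
  have hA : MeasurableSet {x | a n * (x - p) ∈ O} :=
    (hO.preimage (by fun_prop : Continuous fun x => a n * (x - p))).measurableSet
  have hνA := le_withDensity_of_Ioo (f := F n) (S := Set.Ioo 0 1)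
    (A := {x | a n * (x - p) ∈ O})
    (D := B n * m * exp (-((σ / 2 + ε) * (|y| + ε) ^ 2 / (a n ^ 2 / n))))
    (u := p + (y - ρ) / a n) (v := p + (y + ρ) / a n) hA (by positivity)
    (fun x hx => hball' (by
      rw [Metric.mem_ball, Real.dist_eq]
      exact (hI x hx).trans_le (min_le_left _ _)))
    (fun x hx => (hloc x ((hI2 x hx).trans_lt hsmall)).1)
    (fun x hx => by
      obtain ⟨h2, h3⟩ := hloc x ((hI2 x hx).trans_lt hsmall)
      refine le_trans ?_ (h.lower n hr x h2)
      gcongr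
      have h4 : w x ≤ (σ / 2 + ε) * (x - p) ^ 2 := by linarith [(abs_le.1 h3).2]
      have h5 : (x - p) ^ 2 ≤ ((|y| + ε) / a n) ^ 2 := by
        rw [← sq_abs (x - p)]
        have := hI2 x hx
        gcongr
      calc (n : ℝ) * w x ≤ n * ((σ / 2 + ε) * ((|y| + ε) / a n) ^ 2) := by
            gcongr
            exact h4.trans (by gcongr)
        _ = (σ / 2 + ε) * (|y| + ε) ^ 2 / (a n ^ 2 / n) := by field_simp)
  have hlen : p + (y + ρ) / a n - (p + (y - ρ) / a n) = 2 * ρ / a n := by ring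
  rw [hlen] at hνA
  refine le_trans (ENNReal.ofReal_le_ofReal ?_)
    (le_normalized_apply hc hμc (by positivity) (by positivity) hmass hνA)
  rw [div_lt_one hsn] at han
  set E := exp (-((σ / 2 + ε) * (|y| + ε) ^ 2 / (a n ^ 2 / n)))
  have hE : 0 < E := exp_pos _
  set Q := √(π / (κ / 2))
  have hQ : 0 < Q := by positivity
  calc m * (2 * ρ) / (M * Q) * E ≤ m * (2 * ρ) / (M * Q) * E * (√n / a n) := by
        apply le_mul_of_one_le_right (by positivity)
        rw [one_le_div ha0]
        exact han.le
    _ = B n * m * E * (2 * ρ / a n) / (B n * M * (Q / √n)) := by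
        field_simp

end QuadraticDensity

/-- The density `exp (-n V) (x (1 - x)) ^ (n - r)` is controlled by the exponent
`V - log (x (1 - x))`, normalized to vanish at its minimizer. -/
lemma quadraticDensity_moments {V W : ℝ → ℝ} (hVd : ContDiffOn ℝ 2 V (Set.Ioo 0 1))
    (hVc : ContinuousOn V (Set.Icc 0 1)) (hW : W = fun p => V p - log (p * (1 - p))) {p₀ : ℝ}
    (hp₀ : p₀ ∈ Set.Ioo (0 : ℝ) 1) (hmin : ∀ p ∈ Set.Ioo (0 : ℝ) 1, p ≠ p₀ → W p₀ < W p)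
    (hW'' : 0 < deriv (deriv W) p₀) (r : ℕ) :
    ∃ B κ m M, QuadraticDensity (fun n x => exp (-(n : ℝ) * V x) * (x * (1 - x)) ^ (n - r))
      (fun x => W x - W p₀) B p₀ (deriv (deriv W) p₀) κ m M r := by
  set σ := deriv (deriv W) p₀ with hσ
  have hnhds : Set.Ioo (0 : ℝ) 1 ∈ 𝓝 p₀ := isOpen_Ioo.mem_nhds hp₀
  have hWd : ContDiffOn ℝ 2 W (Set.Ioo 0 1) := by
    rw [hW]
    refine hVd.sub (ContDiffOn.log (by fun_prop) fun x hx => ?_)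
    exact (mul_pos hx.1 (by linarith [hx.2])).ne'
  have hW0 : ∀ p ∈ Set.Ioo (0 : ℝ) 1, W p₀ ≤ W p := fun p hp => by
    rcases eq_or_ne p p₀ with rfl | hne
    · exact le_rfl
    · exact (hmin p hp hne).le
  have hlit := isLittleO_sub_quadratic_of_isLocalMin isOpen_Ioo (convex_Ioo 0 1) hp₀ hWd
    (by filter_upwards [hnhds] with x hx using hW0 x hx)
  have hloc : ∀ ε > 0, ∃ δ > 0, ∀ x, |x - p₀| < δ →
      x ∈ Set.Ioo (0 : ℝ) 1 ∧ |W x - W p₀ - σ / 2 * (x - p₀) ^ 2| ≤ ε * (x - p₀) ^ 2 := by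
    intro ε hε
    obtain ⟨δ, hδ, h⟩ := Metric.eventually_nhds_iff.1 ((hlit.bound hε).and hnhds)
    refine ⟨δ, hδ, fun x hx => ⟨(h hx).2, ?_⟩⟩
    simpa [hσ] using (h hx).1
  obtain ⟨δ, hδ, hδloc⟩ := hloc (σ / 4) (by positivity)
  obtain ⟨η, hη, hgap⟩ := exists_gap (w₀ := W p₀) hVc hδ (by simpa [hW] using hmin)
  obtain ⟨C, hC⟩ := isCompact_Icc.exists_bound_of_continuousOn hVc
  have hF : ∀ n, r < n → ∀ x ∈ Set.Ioo (0 : ℝ) 1,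
      exp (-(n : ℝ) * V x) * (x * (1 - x)) ^ (n - r)
        = exp (-((n : ℝ) - r) * W p₀) * exp (-r * V x) * exp (-((n - r) * (W x - W p₀))) := by
    intro n hn x hx
    have hx0 : 0 < x * (1 - x) := mul_pos hx.1 (by linarith [hx.2])
    rw [← exp_log (pow_pos hx0 (n - r)), log_pow, Nat.cast_sub hn.le, ← exp_add, ← exp_add,
      ← exp_add]
    congr 1
    simp only [hW]
    ring
  have hr0 : (0 : ℝ) ≤ r := r.cast_nonneg
  refine ⟨fun n => exp (-((n : ℝ) - r) * W p₀), min (σ / 4) η, exp (-(r * C)), exp (r * C),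
    hW'', lt_min (by positivity) hη, exp_pos _, exp_pos _, fun _ => exp_pos _, ?_, ?_, ?_, hloc⟩
  · intro n hn x hx
    rw [hF n hn x hx]
    have h1 := (abs_le.1 (hC x (Set.Ioo_subset_Icc_self hx))).2
    have h2 := hW0 x hx
    gcongr
    · nlinarith
    · linarith
  · intro n hn x hx
    rw [hF n hn x hx]
    have h1 := (abs_le.1 (hC x (Set.Ioo_subset_Icc_self hx))).1
    have h2 : exp (-r * V x) ≤ exp (r * C) := exp_le_exp.2 (by nlinarith)
    exact mul_le_mul_of_nonneg_right (mul_le_mul_of_nonneg_left h2 (exp_pos _).le) (exp_pos _).le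
  · intro x hx
    by_cases hxδ : |x - p₀| < δ
    · have h1 := (abs_le.1 (hδloc x hxδ).2).1
      have h2 : min (σ / 4) η * (x - p₀) ^ 2 ≤ σ / 4 * (x - p₀) ^ 2 := by
        gcongr
        exact min_le_left _ _
      linarith
    · have h1 := hgap x hx (not_lt.1 hxδ)
      have h2 : (x - p₀) ^ 2 ≤ 1 := by
        rw [sq_le_one_iff_abs_le_one, abs_le]
        constructor <;> linarith [hx.1, hx.2, hp₀.1, hp₀.2]
      have h3 : min (σ / 4) η * (x - p₀) ^ 2 ≤ η * 1 := by
        gcongr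
        exact min_le_right _ _
      have h4 : W x = V x - log (x * (1 - x)) := by rw [hW]
      linarith

/-- One-dimensional moderate deviations: if `X_n` has density proportional
to `e^{-nV(x)} (x(1-x))^{n-r}` on `(0,1)`, `a_n → ∞`, `a_n/√n → 0` and `b_n = n/a_n²`, then
`a_n (X_n - p*)` satisfies an LDP with speed `b_n` and good rate function
`J(x) = W''(p*) x²/2`. -/
theorem statement18 (V : ℝ → ℝ)
    (hVd : ContDiffOn ℝ 2 V (Set.Ioo 0 1)) (hVc : ContinuousOn V (Set.Icc 0 1))
    (W : ℝ → ℝ) (hW : W = fun p => V p - Real.log (p * (1 - p)))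
    (ps : ℝ) (hps : ps ∈ Set.Ioo (0 : ℝ) 1)
    (hmin : ∀ p ∈ Set.Ioo (0 : ℝ) 1, p ≠ ps → W ps < W p)
    (hW'' : 0 < deriv (deriv W) ps)
    (r : ℕ) (hr : 1 ≤ r)
    (μ : ℕ → Measure ℝ)
    (hprob : ∀ n : ℕ, r < n → IsProbabilityMeasure (μ n))
    (hμ : ∀ n : ℕ, r < n → ∃ c : ℝ, 0 < c ∧ μ n =
      (ENNReal.ofReal c)⁻¹ • ((volume.restrict (Set.Ioo 0 1)).withDensity
        (fun x => ENNReal.ofReal (Real.exp (-(n : ℝ) * V x) * (x * (1 - x)) ^ (n - r)))))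
    (a : ℕ → ℝ) (ha : Tendsto a atTop atTop)
    (ha' : Tendsto (fun n : ℕ => a n / Real.sqrt n) atTop (𝓝 0)) :
    (∀ U : Set ℝ, IsClosed U →
      Filter.limsup (fun n : ℕ => ((a n ^ 2 / (n : ℝ) : ℝ) : EReal) *
          ENNReal.log (μ n {x | a n * (x - ps) ∈ U})) atTop
        ≤ - sInf ((fun x : ℝ => ((deriv (deriv W) ps * x ^ 2 / 2 : ℝ) : EReal)) '' U)) ∧
    (∀ O : Set ℝ, IsOpen O →
      - sInf ((fun x : ℝ => ((deriv (deriv W) ps * x ^ 2 / 2 : ℝ) : EReal)) '' O)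
        ≤ Filter.liminf (fun n : ℕ => ((a n ^ 2 / (n : ℝ) : ℝ) : EReal) *
            ENNReal.log (μ n {x | a n * (x - ps) ∈ O})) atTop) := by
  obtain ⟨B, κ, m, M, hQ⟩ := quadraticDensity_moments hVd hVc hW hps hmin hW'' r
  set σ := deriv (deriv W) ps with hσ
  have hs : Tendsto (fun n : ℕ => a n ^ 2 / (n : ℝ)) atTop (𝓝 0) := by
    have h := ha'.pow 2
    simp only [div_pow, ne_eq, OfNat.ofNat_ne_zero, not_false_eq_true, zero_pow] at h
    refine h.congr fun n => ?_
    rw [sq_sqrt n.cast_nonneg]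
  have hs0 : ∀ᶠ n : ℕ in atTop, 0 < a n ^ 2 / (n : ℝ) := by
    filter_upwards [ha.eventually_gt_atTop 0, eventually_gt_atTop 0] with n h1 h2
    have : (0 : ℝ) < n := by exact_mod_cast h2
    positivity
  constructor
  · intro U hU
    rcases U.eq_empty_or_nonempty with rfl | hne
    · simp only [Set.mem_empty_iff_false, Set.ofPred_false, measure_empty, ENNReal.log_zero]
      have h : (fun n : ℕ => ((a n ^ 2 / (n : ℝ) : ℝ) : EReal) * ⊥) =ᶠ[atTop] fun _ => ⊥ := by
        filter_upwards [hs0] with n hn using EReal.coe_mul_bot_of_pos hn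
      rw [limsup_congr h, limsup_const]
      exact bot_le
    by_cases h0 : (0 : ℝ) ∈ U
    · have h1 : sInf ((fun x : ℝ => ((σ * x ^ 2 / 2 : ℝ) : EReal)) '' U) ≤ 0 :=
        sInf_le ⟨0, h0, by simp⟩
      refine le_trans ?_ (EReal.neg_le_neg_iff.2 h1)
      rw [neg_zero]
      refine limsup_le_of_le (h := ?_)
      filter_upwards [hs0, eventually_gt_atTop r] with n hn hr
      have := hprob n hr
      have hlog : ENNReal.log (μ n {x | a n * (x - ps) ∈ U}) ≤ 0 := by
        rw [ENNReal.log_le_zero_iff]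
        exact prob_le_one
      calc _ ≤ ((a n ^ 2 / (n : ℝ) : ℝ) : EReal) * 0 :=
            mul_le_mul_of_nonneg_left hlog (by exact_mod_cast hn.le)
        _ = 0 := mul_zero _
    · obtain ⟨y, hyU, hy⟩ := hU.exists_infDist_eq_dist hne 0
      rw [Real.dist_eq, zero_sub, abs_neg] at hy
      have hy0 : 0 < |y| := abs_pos.2 fun h => h0 (h ▸ hyU)
      have h1 : sInf ((fun x : ℝ => ((σ * x ^ 2 / 2 : ℝ) : EReal)) '' U)
          ≤ ((σ * y ^ 2 / 2 : ℝ) : EReal) := sInf_le ⟨y, hyU, rfl⟩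
      refine le_trans ?_ (EReal.neg_le_neg_iff.2 h1)
      have hlim : Tendsto (fun θ : ℝ => ((-(θ ^ 2 * (σ * |y| ^ 2 / 2)) : ℝ) : EReal)) (𝓝[<] 1)
          (𝓝 (-((σ * y ^ 2 / 2 : ℝ) : EReal))) := by
        refine tendsto_nhdsWithin_of_tendsto_nhds ?_
        rw [← EReal.coe_neg]
        refine (continuous_coe_real_ereal.tendsto _).comp ?_
        have hc : Continuous fun θ : ℝ => -(θ ^ 2 * (σ * |y| ^ 2 / 2)) := by fun_prop
        simpa using hc.tendsto 1
      refine ge_of_tendsto hlim ?_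
      filter_upwards [Ioo_mem_nhdsLT (zero_lt_one (α := ℝ))] with θ hθ
      obtain ⟨C, hC, hb⟩ := hQ.upper_bound hprob hμ ha (t := |y|) hθ.1 hθ.2
      refine limsup_mul_log_le hC hs hs0 ?_
      filter_upwards [hb] with n hn
      refine hn _ (hU.preimage
        (by fun_prop : Continuous fun x => a n * (x - ps))).measurableSet (fun x hx => ?_) hy0
      rw [← hy]
      simpa [Real.dist_eq] using
        Metric.infDist_le_dist_of_mem (x := 0) (show a n * (x - ps) ∈ U from hx)
  · intro O hO
    rw [EReal.neg_le]
    refine le_sInf ?_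
    rintro _ ⟨y, hy, rfl⟩
    rw [EReal.neg_le]
    have hlim : Tendsto (fun ε : ℝ => ((-((σ / 2 + ε) * (|y| + ε) ^ 2) : ℝ) : EReal)) (𝓝[>] 0)
        (𝓝 (-((σ * y ^ 2 / 2 : ℝ) : EReal))) := by
      refine tendsto_nhdsWithin_of_tendsto_nhds ?_
      rw [← EReal.coe_neg]
      refine (continuous_coe_real_ereal.tendsto _).comp ?_
      have hc : Continuous fun ε : ℝ => -((σ / 2 + ε) * (|y| + ε) ^ 2) := by fun_prop
      convert hc.tendsto 0 using 2
      simp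
      ring
    refine le_of_tendsto hlim ?_
    filter_upwards [self_mem_nhdsWithin] with ε hε
    obtain ⟨C, hC, hb⟩ := hQ.lower_bound hprob hμ ha ha' hO hy hε
    exact le_liminf_mul_log hC hs hs0 hb

end
end
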